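/- Suppose η < 1 and let μ_p be the unique absolutely continuous stationary probability measure for F. Then the density dμ_p/dλ is bounded away from zero on (0,1], and on each of the intervals (0,1/2] and (1/2,1] it is decreasing and locally Lipschitz. Furthermore, for each β ∈ (α_min,γ) ∩ (0,1] there exist constants a₁, a₂ > 0 such that dμ_p/dλ(x) ≤ a₁·x^{−α_min−1+β} for all x ∈ (0,1/2] and dμ_p/dλ(x) ≤ a₂·(x−1/2)^{−1+β} for all x ∈ (1/2,1]. -/

import Mathlib

open MeasureTheory Set

/-- Left branch of the LSV-type maps: `x ↦ x(1 + 2^α x^α)`. -/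
noncomputable def lsvLeft (α x : ℝ) : ℝ := x * (1 + 2 ^ α * x ^ α)

/-- The LSV map `S_α`. -/
noncomputable def lsvMap (α : ℝ) (x : ℝ) : ℝ :=
  if x ≤ 1 / 2 then lsvLeft α x else 2 * x - 1

/-- The map `R_{α,K}`. -/
noncomputable def rMap (α K : ℝ) (x : ℝ) : ℝ :=
  if x ≤ 1 / 2 then lsvLeft α x
  else 1 / 2 + K * (x - 1 / 2) + 2 * (1 - K) * (x - 1 / 2) ^ 2

namespace LSV

/-- Nonnegative decreasing functions on `(a, b]` whose decrease is at most polynomial in the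
distance to `a`. -/
structure PieceCone (q : ℕ) (a b : ℝ) (f : ℝ → ℝ) : Prop where
  nonneg : ∀ x ∈ Ioc a b, 0 ≤ f x
  anti : AntitoneOn f (Ioc a b)
  mono : MonotoneOn (fun x => (x - a) ^ q * f x) (Ioc a b)

namespace PieceCone

variable {q : ℕ} {a b : ℝ} {f g : ℝ → ℝ}

theorem zero : PieceCone q a b (fun _ => 0) :=
  ⟨fun _ _ => le_rfl, fun _ _ _ _ _ => le_rfl, fun _ _ _ _ _ => by simp⟩

theorem congr (hf : PieceCone q a b f) (h : ∀ x ∈ Ioc a b, g x = f x) : PieceCone q a b g where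
  nonneg x hx := by rw [h x hx]; exact hf.nonneg x hx
  anti x hx y hy hxy := by rw [h x hx, h y hy]; exact hf.anti hx hy hxy
  mono x hx y hy hxy := by
    simp only [h x hx, h y hy]; exact hf.mono hx hy hxy

theorem add (hf : PieceCone q a b f) (hg : PieceCone q a b g) :
    PieceCone q a b (fun x => f x + g x) where
  nonneg x hx := add_nonneg (hf.nonneg x hx) (hg.nonneg x hx)
  anti x hx y hy hxy := add_le_add (hf.anti hx hy hxy) (hg.anti hx hy hxy)
  mono x hx y hy hxy := by
    have h1 := hf.mono hx hy hxy
    have h2 := hg.mono hx hy hxy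
    simp only [mul_add] at *
    exact add_le_add h1 h2

theorem const_mul (hf : PieceCone q a b f) {c : ℝ} (hc : 0 ≤ c) :
    PieceCone q a b (fun x => c * f x) where
  nonneg x hx := mul_nonneg hc (hf.nonneg x hx)
  anti x hx y hy hxy := mul_le_mul_of_nonneg_left (hf.anti hx hy hxy) hc
  mono x hx y hy hxy := by
    have h1 := mul_le_mul_of_nonneg_left (hf.mono hx hy hxy) hc
    simp only [mul_left_comm _ c] at *
    exact h1

theorem sum {ι : Type*} (s : Finset ι) {F : ι → ℝ → ℝ} (hF : ∀ i ∈ s, PieceCone q a b (F i)) :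
    PieceCone q a b (fun x => ∑ i ∈ s, F i x) where
  nonneg x hx := Finset.sum_nonneg fun i hi => (hF i hi).nonneg x hx
  anti x hx y hy hxy := Finset.sum_le_sum fun i hi => (hF i hi).anti hx hy hxy
  mono x hx y hy hxy := by
    simp only [Finset.mul_sum]
    exact Finset.sum_le_sum fun i hi => (hF i hi).mono hx hy hxy

theorem max (hf : PieceCone q a b f) (hg : PieceCone q a b g) :
    PieceCone q a b (fun x => max (f x) (g x)) where
  nonneg x hx := le_max_of_le_left (hf.nonneg x hx)
  anti x hx y hy hxy := max_le_max (hf.anti hx hy hxy) (hg.anti hx hy hxy)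
  mono x hx y hy hxy := by
    have hx' : 0 ≤ (x - a) ^ q := pow_nonneg (sub_nonneg.2 hx.1.le) q
    have hy' : 0 ≤ (y - a) ^ q := pow_nonneg (sub_nonneg.2 hy.1.le) q
    simp only [mul_max_of_nonneg _ _ hx', mul_max_of_nonneg _ _ hy']
    exact max_le_max (hf.mono hx hy hxy) (hg.mono hx hy hxy)

theorem of_tendsto {ι : Type*} {l : Filter ι} [l.NeBot] {F : ι → ℝ → ℝ}
    (hF : ∀ i, PieceCone q a b (F i))
    (h : ∀ x ∈ Ioc a b, Filter.Tendsto (fun i => F i x) l (nhds (f x))) : PieceCone q a b f where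
  nonneg x hx := ge_of_tendsto' (h x hx) fun i => (hF i).nonneg x hx
  anti x hx y hy hxy := le_of_tendsto_of_tendsto' (h y hy) (h x hx) fun i => (hF i).anti hx hy hxy
  mono x hx y hy hxy := le_of_tendsto_of_tendsto' ((h x hx).const_mul _) ((h y hy).const_mul _)
    fun i => (hF i).mono hx hy hxy

theorem subpiece (hf : PieceCone q a b f) {a' b' : ℝ} (ha : a ≤ a') (hb : b' ≤ b) :
    PieceCone q a' b' f where
  nonneg x hx := hf.nonneg x ⟨ha.trans_lt hx.1, hx.2.trans hb⟩
  anti := hf.anti.mono (Ioc_subset_Ioc ha hb)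
  mono x hx y hy hxy := by
    have hx2 : x ∈ Ioc a b := ⟨ha.trans_lt hx.1, hx.2.trans hb⟩
    have hy2 : y ∈ Ioc a b := ⟨ha.trans_lt hy.1, hy.2.trans hb⟩
    have hxa : 0 < x - a := sub_pos.2 hx2.1
    have hya : 0 < y - a := sub_pos.2 hy2.1
    have hxa' : 0 < x - a' := sub_pos.2 hx.1
    have hya' : 0 < y - a' := sub_pos.2 hy.1
    have key : (x - a') / (x - a) ≤ (y - a') / (y - a) := by
      rw [div_le_div_iff₀ hxa hya]; nlinarith
    have key2 := pow_le_pow_left₀ (div_nonneg hxa'.le hxa.le) key q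
    have h1 := mul_le_mul key2 (hf.mono hx2 hy2 hxy)
      (mul_nonneg (pow_nonneg hxa.le q) (hf.nonneg x hx2))
      (pow_nonneg (div_nonneg hya'.le hya.le) q)
    have e : ∀ z, 0 < z - a → ((z - a') / (z - a)) ^ q * ((z - a) ^ q * f z)
        = (z - a') ^ q * f z := by
      intro z hz
      rw [← mul_assoc, ← mul_pow, div_mul_cancel₀ _ hz.ne']
    simp only at h1
    rwa [e x hxa, e y hya] at h1

/-- The quantitative modulus of continuity satisfied by cone functions. -/
theorem sub_le (hf : PieceCone q a b f) {x y : ℝ} (hx : a < x) (hy : y ≤ b) (hxy : x ≤ y) :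
    f x - f y ≤ f x * (q / (x - a)) * (y - x) := by
  have hx2 : x ∈ Ioc a b := ⟨hx, hxy.trans hy⟩
  have hy2 : y ∈ Ioc a b := ⟨hx.trans_le hxy, hy⟩
  have hxa : 0 < x - a := sub_pos.2 hx
  have hya : 0 < y - a := sub_pos.2 hy2.1
  have hm : (x - a) ^ q * f x ≤ (y - a) ^ q * f y := hf.mono hx2 hy2 hxy
  have hb : 1 - q * ((y - x) / (y - a)) ≤ ((x - a) / (y - a)) ^ q := by
    have h := one_add_mul_le_pow (a := -((y - x) / (y - a))) (by
      have : (y - x) / (y - a) ≤ 1 := by rw [div_le_one hya]; linarith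
      linarith) q
    have e : 1 + -((y - x) / (y - a)) = (x - a) / (y - a) := by field_simp; ring
    rw [e] at h; linarith
  have h3 : ((x - a) / (y - a)) ^ q * f x ≤ f y := by
    rw [div_pow, div_mul_eq_mul_div, div_le_iff₀ (pow_pos hya q)]; linarith
  have hfx := hf.nonneg x hx2
  have h4 := mul_le_mul_of_nonneg_right hb hfx
  have h5 : (y - x) / (y - a) ≤ (y - x) / (x - a) :=
    div_le_div_of_nonneg_left (by linarith) hxa (by linarith)
  have h6 : f x * (q * ((y - x) / (y - a))) ≤ f x * (q * ((y - x) / (x - a))) := by gcongr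
  have e : f x * (q / (x - a)) * (y - x) = f x * (q * ((y - x) / (x - a))) := by ring
  rw [e]; linarith

theorem abs_sub_le (hf : PieceCone q a b f) {z x y : ℝ} (hz : a < z) (hx : x ∈ Icc z b)
    (hy : y ∈ Icc z b) : |f x - f y| ≤ f z * (q / (z - a)) * |x - y| := by
  wlog hxy : x ≤ y generalizing x y
  · rw [abs_sub_comm, abs_sub_comm x]; exact this hy hx (le_of_not_ge hxy)
  have hxa := hz.trans_le hx.1
  have hx2 : x ∈ Ioc a b := ⟨hxa, hx.2⟩
  have hy2 : y ∈ Ioc a b := ⟨hz.trans_le hy.1, hy.2⟩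
  have hz2 : z ∈ Ioc a b := ⟨hz, hx.1.trans hx.2⟩
  have h1 := hf.anti hx2 hy2 hxy
  have h2 := hf.anti hz2 hx2 hx.1
  rw [abs_of_nonneg (by linarith), abs_sub_comm, abs_of_nonneg (by linarith)]
  refine (hf.sub_le hxa hy.2 hxy).trans ?_
  have := hf.nonneg x hx2
  have h3 : 0 < z - a := sub_pos.2 hz
  have h4 : (q : ℝ) / (x - a) ≤ q / (z - a) :=
    div_le_div_of_nonneg_left (by positivity) h3 (by linarith [hx.1])
  have h5 : (0 : ℝ) ≤ q / (x - a) := div_nonneg (by positivity) (by linarith)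
  have h6 : 0 ≤ y - x := by linarith
  have h7 : 0 ≤ f z := hf.nonneg z hz2
  gcongr

theorem locallyLipschitzOn (hf : PieceCone q a b f) : LocallyLipschitzOn (Ioc a b) f := by
  intro x hx
  set z := (a + x) / 2 with hz
  have haz : a < z := by have := hx.1; rw [hz]; linarith
  have hzx : z < x := by have := hx.1; rw [hz]; linarith
  refine ⟨(f z * (q / (z - a))).toNNReal, Icc z b, ?_, ?_⟩
  · filter_upwards [mem_nhdsWithin_of_mem_nhds (Ioi_mem_nhds hzx), self_mem_nhdsWithin]
      with y hy hy2
    exact ⟨(mem_Ioi.1 hy).le, hy2.2⟩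
  · refine LipschitzOnWith.of_dist_le_mul fun u hu v hv => ?_
    rw [Real.dist_eq, Real.dist_eq, Real.coe_toNNReal]
    · exact hf.abs_sub_le haz hu hv
    · exact mul_nonneg (hf.nonneg z ⟨haz, hzx.le.trans hx.2⟩)
        (div_nonneg (by positivity) (by linarith))

theorem continuousOn (hf : PieceCone q a b f) : ContinuousOn f (Ioc a b) :=
  hf.locallyLipschitzOn.continuousOn

theorem aemeasurable (hf : PieceCone q a b f) : AEMeasurable f (volume.restrict (Ioc a b)) :=
  aemeasurable_restrict_of_antitoneOn measurableSet_Ioc hf.anti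

end PieceCone

/-- The cone of functions on `(0, 1]` that lie in the piecewise cones of `(0, 1/2]` and
`(1/2, 1]`. -/
structure InCone (q : ℕ) (f : ℝ → ℝ) : Prop where
  left : PieceCone q 0 (1 / 2) f
  right : PieceCone q (1 / 2) 1 f

theorem mem_halves {x : ℝ} (hx : x ∈ Ioc (0 : ℝ) 1) :
    x ∈ Ioc (0 : ℝ) (1 / 2) ∨ x ∈ Ioc (1 / 2 : ℝ) 1 := by
  rcases le_or_gt x (1 / 2) with h | h
  · exact Or.inl ⟨hx.1, h⟩
  · exact Or.inr ⟨h, hx.2⟩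

theorem union_halves : Ioc (0 : ℝ) (1 / 2) ∪ Ioc (1 / 2 : ℝ) 1 = Ioc 0 1 :=
  Ioc_union_Ioc_eq_Ioc (by norm_num) (by norm_num)

namespace InCone

variable {q : ℕ} {f g : ℝ → ℝ}

theorem nonneg (hf : InCone q f) {x : ℝ} (hx : x ∈ Ioc (0 : ℝ) 1) : 0 ≤ f x :=
  (mem_halves hx).elim (hf.left.nonneg x) (hf.right.nonneg x)

theorem aemeasurable (hf : InCone q f) : AEMeasurable f (volume.restrict (Ioc (0 : ℝ) 1)) := by
  rw [← union_halves, aemeasurable_union_iff]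
  exact ⟨hf.left.aemeasurable, hf.right.aemeasurable⟩

theorem add (hf : InCone q f) (hg : InCone q g) : InCone q (fun x => f x + g x) :=
  ⟨hf.left.add hg.left, hf.right.add hg.right⟩

theorem const_mul (hf : InCone q f) {c : ℝ} (hc : 0 ≤ c) : InCone q (fun x => c * f x) :=
  ⟨hf.left.const_mul hc, hf.right.const_mul hc⟩

theorem sum {ι : Type*} (s : Finset ι) {F : ι → ℝ → ℝ} (hF : ∀ i ∈ s, InCone q (F i)) :
    InCone q (fun x => ∑ i ∈ s, F i x) :=
  ⟨PieceCone.sum s fun i hi => (hF i hi).left, PieceCone.sum s fun i hi => (hF i hi).right⟩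

theorem max (hf : InCone q f) (hg : InCone q g) : InCone q (fun x => max (f x) (g x)) :=
  ⟨hf.left.max hg.left, hf.right.max hg.right⟩

theorem of_tendsto {ι : Type*} {l : Filter ι} [l.NeBot] {F : ι → ℝ → ℝ}
    (hF : ∀ i, InCone q (F i))
    (h : ∀ x ∈ Ioc (0 : ℝ) 1, Filter.Tendsto (fun i => F i x) l (nhds (f x))) : InCone q f where
  left := PieceCone.of_tendsto (fun i => (hF i).left)
    fun x hx => h x ⟨hx.1, hx.2.trans (by norm_num)⟩
  right := PieceCone.of_tendsto (fun i => (hF i).right)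
    fun x hx => h x ⟨lt_trans (by norm_num) hx.1, hx.2⟩

theorem of_pieceCone (hf : PieceCone q 0 1 f) : InCone q f :=
  ⟨hf.subpiece le_rfl (by norm_num), hf.subpiece (by norm_num) le_rfl⟩

theorem eqOn_of_ae_eq (hf : InCone q f) (hg : InCone q g)
    (h : f =ᵐ[volume.restrict (Ioc (0 : ℝ) 1)] g) : ∀ x ∈ Ioc (0 : ℝ) 1, f x = g x := by
  rw [← union_halves] at h
  intro x hx
  rcases mem_halves hx with hx | hx
  · exact Measure.eqOn_Ioc_of_ae_eq _ (ae_restrict_of_ae_restrict_of_subset subset_union_left h)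
      hf.left.continuousOn hg.left.continuousOn hx
  · exact Measure.eqOn_Ioc_of_ae_eq _ (ae_restrict_of_ae_restrict_of_subset subset_union_right h)
      hf.right.continuousOn hg.right.continuousOn hx

end InCone

/-- An increasing branch `(a, b] → (c, d]` of an interval map, with its derivative. -/
structure Branch where
  (a b c d : ℝ)
  (map deriv : ℝ → ℝ)

namespace Branch

/-- The inverse of a branch. -/
noncomputable def inv (B : Branch) (x : ℝ) : ℝ := Function.invFunOn B.map (Ioc B.a B.b) x

open Classical in
/-- The transfer operator of a branch. -/
noncomputable def transfer (B : Branch) (f : ℝ → ℝ) (x : ℝ) : ℝ :=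
  if x ∈ Ioc B.c B.d then f (B.inv x) / B.deriv (B.inv x) else 0

/-- The properties of a branch under which its transfer operator preserves the cones. -/
structure Regular (q : ℕ) (B : Branch) : Prop where
  measurable : Measurable B.map
  image_eq : B.map '' Ioc B.a B.b = Ioc B.c B.d
  strictMono : StrictMonoOn B.map (Ioc B.a B.b)
  hasDeriv : ∀ y ∈ Ioc B.a B.b, HasDerivAt B.map (B.deriv y) y
  deriv_pos : ∀ y ∈ Ioc B.a B.b, 0 < B.deriv y
  deriv_mono : MonotoneOn B.deriv (Ioc B.a B.b)
  ratio_mono : MonotoneOn (fun y => ((B.map y - B.c) / (y - B.a)) ^ q / B.deriv y) (Ioc B.a B.b)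
  cod : (B.c = 0 ∨ B.c = 1 / 2) ∧ B.d = 1

namespace Regular

variable {q : ℕ} {B : Branch} {f g : ℝ → ℝ} (hB : B.Regular q)
include hB

theorem inv_mem {x : ℝ} (hx : x ∈ Ioc B.c B.d) : B.inv x ∈ Ioc B.a B.b :=
  Function.invFunOn_mem (by rw [← hB.image_eq] at hx; exact hx)

theorem map_inv {x : ℝ} (hx : x ∈ Ioc B.c B.d) : B.map (B.inv x) = x :=
  Function.invFunOn_eq (by rw [← hB.image_eq] at hx; exact hx)

theorem map_mem {y : ℝ} (hy : y ∈ Ioc B.a B.b) : B.map y ∈ Ioc B.c B.d := by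
  rw [← hB.image_eq]; exact mem_image_of_mem _ hy

theorem inv_map {y : ℝ} (hy : y ∈ Ioc B.a B.b) : B.inv (B.map y) = y :=
  hB.strictMono.injOn (hB.inv_mem (hB.map_mem hy)) hy (hB.map_inv (hB.map_mem hy))

theorem inv_mono {x y : ℝ} (hx : x ∈ Ioc B.c B.d) (hy : y ∈ Ioc B.c B.d) (hxy : x ≤ y) :
    B.inv x ≤ B.inv y := by
  rw [← hB.strictMono.le_iff_le (hB.inv_mem hx) (hB.inv_mem hy), hB.map_inv hx, hB.map_inv hy]
  exact hxy

omit hB in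
theorem transfer_of_mem {x : ℝ} (hx : x ∈ Ioc B.c B.d) :
    B.transfer f x = f (B.inv x) / B.deriv (B.inv x) := if_pos hx

omit hB in
theorem transfer_of_notMem {x : ℝ} (hx : x ∉ Ioc B.c B.d) :
    B.transfer f x = 0 := if_neg hx

theorem transfer_map {y : ℝ} (hy : y ∈ Ioc B.a B.b) :
    B.transfer f (B.map y) = f y / B.deriv y := by
  rw [transfer_of_mem (hB.map_mem hy), hB.inv_map hy]

theorem transfer_mono (h : ∀ y ∈ Ioc B.a B.b, f y ≤ g y) (x : ℝ) :
    B.transfer f x ≤ B.transfer g x := by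
  by_cases hx : x ∈ Ioc B.c B.d
  · rw [transfer_of_mem hx, transfer_of_mem hx]
    exact div_le_div_of_nonneg_right (h _ (hB.inv_mem hx)) (hB.deriv_pos _ (hB.inv_mem hx)).le
  · rw [transfer_of_notMem hx, transfer_of_notMem hx]

omit hB in
theorem transfer_zero (x : ℝ) : B.transfer (fun _ => 0) x = 0 := by
  unfold transfer; split_ifs <;> simp

theorem transfer_nonneg (h : ∀ y ∈ Ioc B.a B.b, 0 ≤ f y) (x : ℝ) : 0 ≤ B.transfer f x := by
  have := hB.transfer_mono h x
  rwa [transfer_zero] at this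

omit hB in
theorem transfer_add (x : ℝ) :
    B.transfer (fun y => f y + g y) x = B.transfer f x + B.transfer g x := by
  unfold transfer; split_ifs <;> simp [add_div]

omit hB in
theorem transfer_const_mul (c x : ℝ) :
    B.transfer (fun y => c * f y) x = c * B.transfer f x := by
  unfold transfer; split_ifs <;> simp [mul_div_assoc]

theorem tendsto_transfer {ι : Type*} {l : Filter ι} {F : ι → ℝ → ℝ}
    (h : ∀ y ∈ Ioc B.a B.b, Filter.Tendsto (fun i => F i y) l (nhds (f y))) (x : ℝ) :
    Filter.Tendsto (fun i => B.transfer (F i) x) l (nhds (B.transfer f x)) := by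
  by_cases hx : x ∈ Ioc B.c B.d
  · simp only [transfer_of_mem hx]
    exact (h _ (hB.inv_mem hx)).div_const _
  · simp only [transfer_of_notMem hx]
    exact tendsto_const_nhds

theorem pieceCone_transfer (hf : PieceCone q B.a B.b f) :
    PieceCone q B.c B.d (B.transfer f) where
  nonneg x _ := hB.transfer_nonneg hf.nonneg x
  anti x hx y hy hxy := by
    rw [transfer_of_mem hx, transfer_of_mem hy]
    have hx' := hB.inv_mem hx
    have hy' := hB.inv_mem hy
    have hle := hB.inv_mono hx hy hxy
    exact div_le_div₀ (hf.nonneg _ hx') (hf.anti hx' hy' hle) (hB.deriv_pos _ hx')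
      (hB.deriv_mono hx' hy' hle)
  mono x hx y hy hxy := by
    have hx' := hB.inv_mem hx
    have hy' := hB.inv_mem hy
    have hle := hB.inv_mono hx hy hxy
    have e : ∀ z ∈ Ioc B.c B.d, (z - B.c) ^ q * B.transfer f z =
        ((B.map (B.inv z) - B.c) / (B.inv z - B.a)) ^ q / B.deriv (B.inv z) *
          ((B.inv z - B.a) ^ q * f (B.inv z)) := by
      intro z hz
      rw [transfer_of_mem hz, hB.map_inv hz, div_pow]
      have h1 : (B.inv z - B.a) ^ q ≠ 0 := pow_ne_zero _ (sub_pos.2 (hB.inv_mem hz).1).ne'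
      have h2 := (hB.deriv_pos _ (hB.inv_mem hz)).ne'
      field_simp
    simp only [e x hx, e y hy]
    have hmap := hB.map_mem hy'
    refine mul_le_mul (hB.ratio_mono hx' hy' hle) (hf.mono hx' hy' hle)
      (mul_nonneg (pow_nonneg (sub_pos.2 hx'.1).le _) (hf.nonneg _ hx')) ?_
    exact div_nonneg (pow_nonneg (div_nonneg (sub_pos.2 hmap.1).le (sub_pos.2 hy'.1).le) _)
      (hB.deriv_pos _ hy').le

theorem inCone_transfer (hf : PieceCone q B.a B.b f) : InCone q (B.transfer f) := by
  have h := hB.pieceCone_transfer hf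
  obtain ⟨hc, hd⟩ := hB.cod
  rcases hc with hc | hc
  · rw [hc, hd] at h
    exact InCone.of_pieceCone h
  · refine ⟨PieceCone.zero.congr fun x hx => transfer_of_notMem fun h' => ?_, ?_⟩
    · rw [hc] at h'; exact absurd h'.1 (not_lt.2 hx.2)
    · rwa [hc, hd] at h

theorem lintegral_transfer {A : Set ℝ} (hA : MeasurableSet A) :
    ∫⁻ x in A ∩ Ioc 0 1, ENNReal.ofReal (B.transfer f x) =
      ∫⁻ y in B.map ⁻¹' A ∩ Ioc B.a B.b, ENNReal.ofReal (f y) := by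
  have hmeas : MeasurableSet (B.map ⁻¹' A ∩ Ioc B.a B.b) :=
    (hB.measurable hA).inter measurableSet_Ioc
  have hsub : A ∩ Ioc B.c B.d ⊆ A ∩ Ioc 0 1 := by
    obtain ⟨hc, hd⟩ := hB.cod
    refine inter_subset_inter_right _ (Ioc_subset_Ioc ?_ hd.le)
    rcases hc with hc | hc <;> rw [hc]; norm_num
  have himg : B.map '' (B.map ⁻¹' A ∩ Ioc B.a B.b) = A ∩ Ioc B.c B.d := by
    rw [image_preimage_inter, hB.image_eq]
  have h1 : ∫⁻ x in A ∩ Ioc 0 1, ENNReal.ofReal (B.transfer f x) =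
      ∫⁻ x in A ∩ Ioc B.c B.d, ENNReal.ofReal (B.transfer f x) := by
    rw [← inter_eq_right.2 hsub, inter_comm (A ∩ Ioc 0 1),
      ← setLIntegral_indicator (hA.inter measurableSet_Ioc)]
    refine setLIntegral_congr_fun (hA.inter measurableSet_Ioc) fun x hx => ?_
    by_cases h : x ∈ Ioc B.c B.d
    · rw [indicator_of_mem (show x ∈ A ∩ Ioc B.c B.d from ⟨hx.1, h⟩)]
    · rw [indicator_of_notMem fun h' => h h'.2, transfer_of_notMem h, ENNReal.ofReal_zero]
  rw [h1, ← himg, lintegral_image_eq_lintegral_abs_deriv_mul hmeas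
    (fun y hy => (hB.hasDeriv y hy.2).hasDerivWithinAt)
    (hB.strictMono.injOn.mono inter_subset_right)]
  refine setLIntegral_congr_fun hmeas fun y hy => ?_
  have hp := hB.deriv_pos y hy.2
  rw [hB.transfer_map hy.2, ← ENNReal.ofReal_mul (abs_nonneg _), abs_of_pos hp,
    mul_div_cancel₀ _ hp.ne']

end Regular

end Branch

/-- A random system of interval maps with two increasing branches, chosen with
probabilities `p`. -/
structure System (ι : Type*) where
  p : ι → ℝ
  (l r : ι → Branch)

/-- The measure on `(0, 1]` with density `f`. -/
noncomputable def dens (f : ℝ → ℝ) : Measure ℝ :=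
  (volume.restrict (Ioc (0 : ℝ) 1)).withDensity fun x => ENNReal.ofReal (f x)

theorem dens_apply (f : ℝ → ℝ) {A : Set ℝ} (hA : MeasurableSet A) :
    dens f A = ∫⁻ x in A ∩ Ioc 0 1, ENNReal.ofReal (f x) := by
  rw [dens, withDensity_apply _ hA, Measure.restrict_restrict hA]

theorem dens_congr {f g : ℝ → ℝ} (h : ∀ x ∈ Ioc (0 : ℝ) 1, f x = g x) : dens f = dens g := by
  refine withDensity_congr_ae ?_
  filter_upwards [ae_restrict_mem measurableSet_Ioc] with x hx
  rw [h x hx]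

theorem dens_mono {f g : ℝ → ℝ} (h : ∀ x ∈ Ioc (0 : ℝ) 1, f x ≤ g x) : dens f ≤ dens g := by
  refine withDensity_mono ?_
  filter_upwards [ae_restrict_mem measurableSet_Ioc] with x hx
  exact ENNReal.ofReal_le_ofReal (h x hx)

namespace System

variable {ι : Type*} [Fintype ι] (S : System ι)

/-- The maps of the system. -/
noncomputable def map (j : ι) (y : ℝ) : ℝ := if y ≤ 1 / 2 then (S.l j).map y else (S.r j).map y

/-- The averaged transfer operator acting on densities. -/
noncomputable def op (f : ℝ → ℝ) (x : ℝ) : ℝ :=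
  ∑ j, S.p j * ((S.l j).transfer f x + (S.r j).transfer f x)

/-- The averaged push-forward acting on measures. -/
noncomputable def push (ν : Measure ℝ) : Measure ℝ :=
  ∑ j, ENNReal.ofReal (S.p j) • ν.map (S.map j)

/-- Standing assumptions on a system. -/
structure Regular (q : ℕ) : Prop where
  p_pos : ∀ j, 0 < S.p j
  p_sum : ∑ j, S.p j = 1
  left : ∀ j, (S.l j).Regular q
  right : ∀ j, (S.r j).Regular q
  left_a : ∀ j, (S.l j).a = 0
  left_b : ∀ j, (S.l j).b = 1 / 2
  right_a : ∀ j, (S.r j).a = 1 / 2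
  right_b : ∀ j, (S.r j).b = 1

namespace Regular

variable {S} {q : ℕ} (hS : S.Regular q) {f g : ℝ → ℝ}
include hS

theorem left_mem {j : ι} {y : ℝ} : y ∈ Ioc (S.l j).a (S.l j).b ↔ y ∈ Ioc (0 : ℝ) (1 / 2) := by
  rw [hS.left_a, hS.left_b]

theorem right_mem {j : ι} {y : ℝ} : y ∈ Ioc (S.r j).a (S.r j).b ↔ y ∈ Ioc (1 / 2 : ℝ) 1 := by
  rw [hS.right_a, hS.right_b]

theorem left_mem_unit {j : ι} {y : ℝ} (hy : y ∈ Ioc (S.l j).a (S.l j).b) : y ∈ Ioc (0 : ℝ) 1 := by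
  rw [hS.left_mem] at hy; exact ⟨hy.1, hy.2.trans (by norm_num)⟩

theorem right_mem_unit {j : ι} {y : ℝ} (hy : y ∈ Ioc (S.r j).a (S.r j).b) :
    y ∈ Ioc (0 : ℝ) 1 := by
  rw [hS.right_mem] at hy; exact ⟨lt_trans (by norm_num) hy.1, hy.2⟩

theorem inCone_transfer_left (hf : InCone q f) (j : ι) : InCone q ((S.l j).transfer f) :=
  (hS.left j).inCone_transfer (by rw [hS.left_a, hS.left_b]; exact hf.left)

theorem inCone_transfer_right (hf : InCone q f) (j : ι) : InCone q ((S.r j).transfer f) :=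
  (hS.right j).inCone_transfer (by rw [hS.right_a, hS.right_b]; exact hf.right)

theorem inCone_op (hf : InCone q f) : InCone q (S.op f) :=
  InCone.sum Finset.univ fun j _ =>
    ((hS.inCone_transfer_left hf j).add (hS.inCone_transfer_right hf j)).const_mul (hS.p_pos j).le

theorem inCone_iterate (hf : InCone q f) (n : ℕ) : InCone q (S.op^[n] f) := by
  induction n with
  | zero => exact hf
  | succ n ih => rw [Function.iterate_succ_apply']; exact hS.inCone_op ih

omit hS in
theorem op_add (x : ℝ) : S.op (fun y => f y + g y) x = S.op f x + S.op g x := by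
  simp only [op, Branch.Regular.transfer_add, ← Finset.sum_add_distrib]
  exact Finset.sum_congr rfl fun j _ => by ring

omit hS in
theorem op_const_mul (c x : ℝ) : S.op (fun y => c * f y) x = c * S.op f x := by
  simp only [op, Branch.Regular.transfer_const_mul, Finset.mul_sum]
  exact Finset.sum_congr rfl fun j _ => by ring

omit hS in
theorem op_sub (x : ℝ) : S.op (fun y => f y - g y) x = S.op f x - S.op g x := by
  have h := op_add (S := S) (f := f) (g := fun y => (-1) * g y) x
  rw [op_const_mul] at h
  have e : (fun y => f y - g y) = fun y => f y + (-1) * g y := by ext; ring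
  rw [e, h]; ring

omit hS in
theorem op_sum {κ : Type*} (s : Finset κ) (F : κ → ℝ → ℝ) (x : ℝ) :
    S.op (fun y => ∑ k ∈ s, F k y) x = ∑ k ∈ s, S.op (F k) x := by
  classical
  induction s using Finset.induction_on with
  | empty => simp [op, Branch.Regular.transfer_zero]
  | insert a s ha ih =>
    simp only [Finset.sum_insert ha]
    rw [op_add, ih]

theorem op_mono (h : ∀ y ∈ Ioc (0 : ℝ) 1, f y ≤ g y) (x : ℝ) : S.op f x ≤ S.op g x :=
  Finset.sum_le_sum fun j _ => mul_le_mul_of_nonneg_left (add_le_add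
    ((hS.left j).transfer_mono (fun y hy => h y (hS.left_mem_unit hy)) x)
    ((hS.right j).transfer_mono (fun y hy => h y (hS.right_mem_unit hy)) x)) (hS.p_pos j).le

theorem tendsto_op {κ : Type*} {L : Filter κ} {F : κ → ℝ → ℝ}
    (h : ∀ y ∈ Ioc (0 : ℝ) 1, Filter.Tendsto (fun i => F i y) L (nhds (f y))) (x : ℝ) :
    Filter.Tendsto (fun i => S.op (F i) x) L (nhds (S.op f x)) :=
  tendsto_finsetSum _ fun j _ => (((hS.left j).tendsto_transfer
    (fun y hy => h y (hS.left_mem_unit hy)) x).add ((hS.right j).tendsto_transfer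
    (fun y hy => h y (hS.right_mem_unit hy)) x)).const_mul _

/-- The contribution of a left preimage to the transfer operator. -/
theorem le_op_left (hf : ∀ y ∈ Ioc (0 : ℝ) 1, 0 ≤ f y) (j : ι) (x : ℝ) :
    S.p j * (S.l j).transfer f x ≤ S.op f x := by
  have hl := fun k => (hS.left k).transfer_nonneg (fun y hy => hf y (hS.left_mem_unit hy)) x
  have hr := fun k => (hS.right k).transfer_nonneg (fun y hy => hf y (hS.right_mem_unit hy)) x
  refine le_trans ?_ (Finset.single_le_sum (f := fun k => S.p k *
    ((S.l k).transfer f x + (S.r k).transfer f x)) (fun k _ =>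
      mul_nonneg (hS.p_pos k).le (add_nonneg (hl k) (hr k))) (Finset.mem_univ j))
  exact mul_le_mul_of_nonneg_left (by linarith [hr j]) (hS.p_pos j).le

/-- The contribution of a right preimage to the transfer operator. -/
theorem le_op_right (hf : ∀ y ∈ Ioc (0 : ℝ) 1, 0 ≤ f y) (j : ι) (x : ℝ) :
    S.p j * (S.r j).transfer f x ≤ S.op f x := by
  have hl := fun k => (hS.left k).transfer_nonneg (fun y hy => hf y (hS.left_mem_unit hy)) x
  have hr := fun k => (hS.right k).transfer_nonneg (fun y hy => hf y (hS.right_mem_unit hy)) x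
  refine le_trans ?_ (Finset.single_le_sum (f := fun k => S.p k *
    ((S.l k).transfer f x + (S.r k).transfer f x)) (fun k _ =>
      mul_nonneg (hS.p_pos k).le (add_nonneg (hl k) (hr k))) (Finset.mem_univ j))
  exact mul_le_mul_of_nonneg_left (by linarith [hl j]) (hS.p_pos j).le

/-- A function fixed by the transfer operator that vanishes at `S_j y` vanishes at `y`. -/
theorem eq_zero_of_map_eq_zero (hf : ∀ y ∈ Ioc (0 : ℝ) 1, 0 ≤ f y)
    (hfix : ∀ x ∈ Ioc (0 : ℝ) 1, S.op f x = f x) (j : ι) {y : ℝ} (hy : y ∈ Ioc (0 : ℝ) 1)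
    (hmy : S.map j y ∈ Ioc (0 : ℝ) 1) (h0 : f (S.map j y) = 0) : f y = 0 := by
  have hop : S.op f (S.map j y) = 0 := by rw [hfix _ hmy, h0]
  refine le_antisymm ?_ (hf y hy)
  rcases mem_halves hy with hy' | hy'
  · have hm : S.map j y = (S.l j).map y := if_pos hy'.2
    have h := hS.le_op_left hf j (S.map j y)
    rw [hop, hm, (hS.left j).transfer_map (hS.left_mem.2 hy')] at h
    have hd := (hS.left j).deriv_pos y (hS.left_mem.2 hy')
    have h2 := nonpos_of_mul_nonpos_right h (hS.p_pos j)
    simpa using (div_le_iff₀ hd).1 h2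
  · have hm : S.map j y = (S.r j).map y := if_neg (not_le.2 hy'.1)
    have h := hS.le_op_right hf j (S.map j y)
    rw [hop, hm, (hS.right j).transfer_map (hS.right_mem.2 hy')] at h
    have hd := (hS.right j).deriv_pos y (hS.right_mem.2 hy')
    have h2 := nonpos_of_mul_nonpos_right h (hS.p_pos j)
    simpa using (div_le_iff₀ hd).1 h2

theorem measurable_map (j : ι) : Measurable (S.map j) :=
  Measurable.ite measurableSet_Iic (hS.left j).measurable (hS.right j).measurable

theorem push_apply (ν : Measure ℝ) {A : Set ℝ} (hA : MeasurableSet A) :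
    S.push ν A = ∑ j, ENNReal.ofReal (S.p j) * ν (S.map j ⁻¹' A) := by
  simp only [push, Measure.finsetSum_apply, Measure.smul_apply, smul_eq_mul]
  exact Finset.sum_congr rfl fun j _ => by rw [Measure.map_apply (hS.measurable_map j) hA]

theorem push_univ (ν : Measure ℝ) : S.push ν univ = ν univ := by
  rw [hS.push_apply ν MeasurableSet.univ]
  simp only [preimage_univ]
  rw [← Finset.sum_mul, ← ENNReal.ofReal_sum_of_nonneg fun j _ => (hS.p_pos j).le, hS.p_sum]
  simp

theorem push_add (ν ν' : Measure ℝ) : S.push (ν + ν') = S.push ν + S.push ν' := by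
  ext A hA
  simp only [hS.push_apply _ hA, Measure.add_apply, mul_add, Finset.sum_add_distrib]

theorem push_mono {ν ν' : Measure ℝ} (h : ν ≤ ν') : S.push ν ≤ S.push ν' := by
  refine Measure.le_iff.2 fun A hA => ?_
  rw [hS.push_apply _ hA, hS.push_apply _ hA]
  exact Finset.sum_le_sum fun j _ => mul_le_mul_right (h _) _

theorem push_dens (hf : InCone q f) : S.push (dens f) = dens (S.op f) := by
  ext A hA
  rw [hS.push_apply _ hA, dens_apply _ hA]
  have hmeas : ∀ (B : Branch), InCone q (B.transfer f) →
      AEMeasurable (fun x => ENNReal.ofReal (B.transfer f x)) (volume.restrict (A ∩ Ioc 0 1)) :=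
    fun B hB => (hB.aemeasurable.mono_measure
      (Measure.restrict_mono inter_subset_right le_rfl)).ennreal_ofReal
  have key : ∀ j, dens f (S.map j ⁻¹' A) =
      ∫⁻ x in A ∩ Ioc 0 1, ENNReal.ofReal ((S.l j).transfer f x) +
        ENNReal.ofReal ((S.r j).transfer f x) := by
    intro j
    rw [dens_apply _ (hS.measurable_map j hA),
      lintegral_add_left' (hmeas _ (hS.inCone_transfer_left hf j)),
      (hS.left j).lintegral_transfer hA, (hS.right j).lintegral_transfer hA,
      hS.left_a, hS.left_b, hS.right_a, hS.right_b]
    have e : S.map j ⁻¹' A ∩ Ioc 0 1 = ((S.l j).map ⁻¹' A ∩ Ioc 0 (1 / 2)) ∪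
        ((S.r j).map ⁻¹' A ∩ Ioc (1 / 2) 1) := by
      rw [← union_halves, inter_union_distrib_left]
      congr 1 <;> ext y
      · refine and_congr_left fun hy => ?_
        rw [mem_preimage, mem_preimage, map, if_pos hy.2]
      · refine and_congr_left fun hy => ?_
        rw [mem_preimage, mem_preimage, map, if_neg (not_le.2 hy.1)]
    rw [e, lintegral_union (((hS.right j).measurable hA).inter measurableSet_Ioc)]
    exact Disjoint.mono inter_subset_right inter_subset_right
      (Ioc_disjoint_Ioc_of_le le_rfl)
  have hl : ∀ j x, 0 ≤ (S.l j).transfer f x := fun j => (hS.left j).transfer_nonneg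
    fun y hy => hf.nonneg (hS.left_mem_unit hy)
  have hr : ∀ j x, 0 ≤ (S.r j).transfer f x := fun j => (hS.right j).transfer_nonneg
    fun y hy => hf.nonneg (hS.right_mem_unit hy)
  simp only [key]
  have e2 : ∀ x, ENNReal.ofReal (S.op f x) = ∑ j, ENNReal.ofReal (S.p j) *
      (ENNReal.ofReal ((S.l j).transfer f x) + ENNReal.ofReal ((S.r j).transfer f x)) := by
    intro x
    rw [op, ENNReal.ofReal_sum_of_nonneg fun j _ =>
      mul_nonneg (hS.p_pos j).le (add_nonneg (hl j x) (hr j x))]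
    exact Finset.sum_congr rfl fun j _ => by
      rw [ENNReal.ofReal_mul (hS.p_pos j).le, ENNReal.ofReal_add (hl j x) (hr j x)]
  have hadd : ∀ j, AEMeasurable (fun x => ENNReal.ofReal ((S.l j).transfer f x) +
      ENNReal.ofReal ((S.r j).transfer f x)) (volume.restrict (A ∩ Ioc 0 1)) :=
    fun j => (hmeas _ (hS.inCone_transfer_left hf j)).add
      (hmeas _ (hS.inCone_transfer_right hf j))
  simp only [e2]
  rw [lintegral_finsetSum' _ fun j _ => (hadd j).const_mul _]
  exact Finset.sum_congr rfl fun j _ => (lintegral_const_mul'' _ (hadd j)).symm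

theorem dens_op_univ (hf : InCone q f) : dens (S.op f) univ = dens f univ := by
  rw [← hS.push_dens hf, hS.push_univ]

end Regular

end System

theorem ratio_le_ratio {q : ℕ} {a c t s : ℝ} (ha : 0 < a) (hc : 1 ≤ c) (hq : c ≤ q) (ht : 0 ≤ t)
    (hts : t ≤ s) : (a + t) ^ q / (a + c * t) ≤ (a + s) ^ q / (a + c * s) := by
  have h1 : 0 < a + t := by positivity
  have h2 : 0 < a + c * t := by positivity
  have h3 : 0 < a + c * s := by nlinarith
  have hst : 0 ≤ s - t := by linarith
  have hb : 1 + q * ((s - t) / (a + t)) ≤ ((a + s) / (a + t)) ^ q := by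
    have h := one_add_mul_le_pow (a := (s - t) / (a + t))
      (by have : 0 ≤ (s - t) / (a + t) := by positivity
          linarith) q
    have e : 1 + (s - t) / (a + t) = (a + s) / (a + t) := by field_simp; ring
    rwa [e] at h
  have h4 : (a + c * s) / (a + c * t) ≤ 1 + q * ((s - t) / (a + t)) := by
    have e : (a + c * s) / (a + c * t) = 1 + c * ((s - t) / (a + c * t)) := by field_simp; ring
    rw [e]
    have : (s - t) / (a + c * t) ≤ (s - t) / (a + t) :=
      div_le_div_of_nonneg_left hst h1 (by nlinarith)
    have h5 : 0 ≤ (s - t) / (a + c * t) := by positivity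
    have := mul_le_mul hq this h5 (by linarith)
    linarith
  have h5 := h4.trans hb
  rw [div_pow, div_le_div_iff₀ h2 (pow_pos h1 q)] at h5
  rw [div_le_div_iff₀ h2 h3]
  linarith

/-- The left branch of the LSV maps. -/
noncomputable def leftBranch (α : ℝ) : Branch where
  a := 0
  b := 1 / 2
  c := 0
  d := 1
  map := lsvLeft α
  deriv y := 1 + (1 + α) * (2 ^ α * y ^ α)

/-- The linear right branch of the LSV maps. -/
noncomputable def linearBranch : Branch where
  a := 1 / 2
  b := 1
  c := 0
  d := 1
  map y := 2 * y - 1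
  deriv _ := 2

/-- The right branch of the maps `R_{α, K}`. -/
noncomputable def quadraticBranch (K : ℝ) : Branch where
  a := 1 / 2
  b := 1
  c := 1 / 2
  d := 1
  map y := 1 / 2 + K * (y - 1 / 2) + 2 * (1 - K) * (y - 1 / 2) ^ 2
  deriv y := K + 4 * (1 - K) * (y - 1 / 2)

theorem two_rpow_mul_rpow_nonneg (α : ℝ) {y : ℝ} (hy : 0 ≤ y) : 0 ≤ (2 : ℝ) ^ α * y ^ α :=
  mul_nonneg (Real.rpow_nonneg (by norm_num) _) (Real.rpow_nonneg hy _)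

theorem two_rpow_mul_rpow_mono {α : ℝ} (hα : 0 < α) {y z : ℝ} (hy : 0 ≤ y) (hyz : y ≤ z) :
    (2 : ℝ) ^ α * y ^ α ≤ (2 : ℝ) ^ α * z ^ α :=
  mul_le_mul_of_nonneg_left (Real.rpow_le_rpow hy hyz hα.le) (Real.rpow_nonneg (by norm_num) _)

theorem two_rpow_mul_half_rpow (α : ℝ) : (2 : ℝ) ^ α * (1 / 2 : ℝ) ^ α = 1 := by
  rw [← Real.mul_rpow (by norm_num) (by norm_num)]; norm_num

theorem two_rpow_mul_rpow_le_one {α : ℝ} (hα : 0 < α) {y : ℝ} (hy : 0 ≤ y) (hy2 : y ≤ 1 / 2) :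
    (2 : ℝ) ^ α * y ^ α ≤ 1 :=
  (two_rpow_mul_rpow_mono hα hy hy2).trans (two_rpow_mul_half_rpow α).le

theorem strictMonoOn_lsvLeft {α : ℝ} (hα : 0 < α) : StrictMonoOn (lsvLeft α) (Ici 0) := by
  intro y hy z hz hyz
  have h1 := two_rpow_mul_rpow_nonneg α (mem_Ici.1 hy)
  have h2 := two_rpow_mul_rpow_mono hα (mem_Ici.1 hy) hyz.le
  have := mem_Ici.1 hy
  simp only [lsvLeft]
  nlinarith

theorem lsvLeft_half (α : ℝ) : lsvLeft α (1 / 2) = 1 := by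
  rw [lsvLeft, two_rpow_mul_half_rpow]; norm_num

theorem continuous_lsvLeft {α : ℝ} (hα : 0 < α) : Continuous (lsvLeft α) := by
  unfold lsvLeft
  have : Continuous fun x : ℝ => x ^ α := Real.continuous_rpow_const hα.le
  fun_prop

theorem image_Ioc_of_strictMonoOn {f : ℝ → ℝ} {a b c d : ℝ} (hab : a ≤ b)
    (hf : ContinuousOn f (Icc a b)) (hm : StrictMonoOn f (Icc a b)) (ha : f a = c) (hb : f b = d) :
    f '' Ioc a b = Ioc c d := by
  subst ha hb
  ext x
  constructor
  · rintro ⟨y, hy, rfl⟩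
    exact ⟨hm (left_mem_Icc.2 hab) (Ioc_subset_Icc_self hy) hy.1,
      hm.monotoneOn (Ioc_subset_Icc_self hy) (right_mem_Icc.2 hab) hy.2⟩
  · intro hx
    obtain ⟨y, hy, rfl⟩ := intermediate_value_Icc hab hf (Ioc_subset_Icc_self hx)
    refine ⟨y, ⟨lt_of_le_of_ne hy.1 ?_, hy.2⟩, rfl⟩
    rintro rfl
    exact lt_irrefl _ hx.1

theorem leftBranch_regular {α : ℝ} (hα : 0 < α) {q : ℕ} (hq : 1 + α ≤ q) :
    (leftBranch α).Regular q where
  measurable := (continuous_lsvLeft hα).measurable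
  image_eq := image_Ioc_of_strictMonoOn (by norm_num [leftBranch])
    (continuous_lsvLeft hα).continuousOn ((strictMonoOn_lsvLeft hα).mono fun _ h => h.1)
    (by simp [leftBranch, lsvLeft]) (lsvLeft_half α)
  strictMono := (strictMonoOn_lsvLeft hα).mono fun _ h => h.1.le
  hasDeriv y hy := by
    have hy0 : 0 < y := hy.1
    have h1 : HasDerivAt (fun x : ℝ => x ^ α) (α * y ^ (α - 1)) y :=
      Real.hasDerivAt_rpow_const (Or.inl hy0.ne')
    have h2 := (hasDerivAt_id' y).mul ((h1.const_mul ((2 : ℝ) ^ α)).const_add 1)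
    have e : y * y ^ (α - 1) = y ^ α := by
      rw [mul_comm, ← Real.rpow_add_one hy0.ne']; ring_nf
    refine h2.congr_deriv ?_
    simp only [leftBranch, one_mul]
    rw [← e]; ring
  deriv_pos y hy := by
    have := two_rpow_mul_rpow_nonneg α (show 0 ≤ y from hy.1.le)
    simp only [leftBranch]; positivity
  deriv_mono y hy z hz hyz := by
    have := two_rpow_mul_rpow_mono hα (show 0 ≤ y from hy.1.le) hyz
    simp only [leftBranch]
    nlinarith
  ratio_mono y hy z hz hyz := by
    have hy0 : 0 < y := hy.1
    have hz0 : 0 < z := hz.1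
    have h := ratio_le_ratio one_pos (by linarith : 1 ≤ 1 + α) hq
      (two_rpow_mul_rpow_nonneg α hy0.le) (two_rpow_mul_rpow_mono hα hy0.le hyz)
    simp only [leftBranch, lsvLeft, sub_zero]
    rwa [mul_div_cancel_left₀ _ hy0.ne', mul_div_cancel_left₀ _ hz0.ne']
  cod := ⟨Or.inl rfl, rfl⟩

theorem linearBranch_regular (q : ℕ) : linearBranch.Regular q where
  measurable := by unfold linearBranch; fun_prop
  image_eq := image_Ioc_of_strictMonoOn (by norm_num [linearBranch])
    (by unfold linearBranch; fun_prop)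
    (fun x _ y _ h => by simp only [linearBranch]; linarith)
    (by norm_num [linearBranch]) (by norm_num [linearBranch])
  strictMono x _ y _ h := by simp only [linearBranch]; linarith
  hasDeriv y _ := by
    refine (((hasDerivAt_id' y).const_mul (2 : ℝ)).sub_const 1).congr_deriv ?_
    norm_num [linearBranch]
  deriv_pos _ _ := by norm_num [linearBranch]
  deriv_mono _ _ _ _ _ := le_rfl
  ratio_mono y hy z hz _ := by
    have e : ∀ w : ℝ, 1 / 2 < w → (2 * w - 1 - 0) / (w - 1 / 2) = 2 := by
      intro w hw
      have : w - 1 / 2 ≠ 0 := (sub_pos.2 hw).ne'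
      rw [div_eq_iff this]; ring
    simp only [linearBranch]
    rw [e y hy.1, e z hz.1]
  cod := ⟨Or.inl rfl, rfl⟩

theorem quadraticBranch_regular {K : ℝ} (hK : K ∈ Ioo (0 : ℝ) 1) {q : ℕ} (hq : 2 ≤ q) :
    (quadraticBranch K).Regular q := by
  obtain ⟨hK0, hK1⟩ := hK
  have hsm : StrictMonoOn (quadraticBranch K).map (Icc (1 / 2) 1) := by
    intro x hx y hy h
    simp only [quadraticBranch]
    have h1 : 0 ≤ x - 1 / 2 := by linarith [hx.1]
    have h2 : (x - 1 / 2) ^ 2 ≤ (y - 1 / 2) ^ 2 := pow_le_pow_left₀ h1 (by linarith) 2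
    have h3 : 0 < 1 - K := by linarith
    nlinarith
  refine ⟨?_, ?_, hsm.mono Ioc_subset_Icc_self, ?_, ?_, ?_, ?_, ⟨Or.inr rfl, rfl⟩⟩
  · unfold quadraticBranch; fun_prop
  · exact image_Ioc_of_strictMonoOn (by norm_num [quadraticBranch])
      (by unfold quadraticBranch; fun_prop) hsm
      (by norm_num [quadraticBranch]) (by simp only [quadraticBranch]; ring)
  · intro y _
    have h1 := (hasDerivAt_id' y).sub_const (1 / 2)
    have h2 := ((h1.const_mul K).const_add (1 / 2)).add ((h1.pow 2).const_mul (2 * (1 - K)))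
    refine h2.congr_deriv ?_
    simp only [quadraticBranch]; norm_num; ring
  · intro y hy
    have : 0 < y - 1 / 2 := sub_pos.2 hy.1
    have h3 : 0 < 1 - K := by linarith
    simp only [quadraticBranch]; positivity
  · intro y hy z hz hyz
    simp only [quadraticBranch]
    have h3 : 0 < 1 - K := by linarith
    nlinarith
  · intro y hy z hz hyz
    have h3 : 0 < 1 - K := by linarith
    have hy0 : 0 < y - 1 / 2 := sub_pos.2 hy.1
    have e : ∀ w : ℝ, 1 / 2 < w →
        ((quadraticBranch K).map w - 1 / 2) / (w - 1 / 2) = K + 2 * (1 - K) * (w - 1 / 2) := by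
      intro w hw
      have : w - 1 / 2 ≠ 0 := (sub_pos.2 hw).ne'
      rw [div_eq_iff this]; simp only [quadraticBranch]; ring
    have h := ratio_le_ratio (q := q) (t := 2 * (1 - K) * (y - 1 / 2))
      (s := 2 * (1 - K) * (z - 1 / 2)) hK0 (one_le_two) (by exact_mod_cast hq)
      (by positivity) (by gcongr)
    have e2 : ∀ w : ℝ, (quadraticBranch K).deriv w = K + 2 * (2 * (1 - K) * (w - 1 / 2)) := by
      intro w; simp only [quadraticBranch]; ring
    change (((quadraticBranch K).map y - 1 / 2) / (y - 1 / 2)) ^ q / (quadraticBranch K).deriv y ≤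
      (((quadraticBranch K).map z - 1 / 2) / (z - 1 / 2)) ^ q / (quadraticBranch K).deriv z
    rwa [e y hy.1, e z hz.1, e2, e2]

/-- Polynomial upper bounds on the two halves of `(0, 1]`. -/
structure PowerBound (α β A B : ℝ) (f : ℝ → ℝ) : Prop where
  left : ∀ x ∈ Ioc (0 : ℝ) (1 / 2), f x ≤ A * x ^ (-α - 1 + β)
  right : ∀ x ∈ Ioc (1 / 2 : ℝ) 1, f x ≤ B * (x - 1 / 2) ^ (-1 + β)

theorem sub_mul_le_mass {q : ℕ} {a b m : ℝ} {f : ℝ → ℝ} (ha : 0 ≤ a) (hb : b ≤ 1)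
    (hf : PieceCone q a b f) (hm : 0 ≤ m) (hmass : dens f univ ≤ ENNReal.ofReal m) {x : ℝ}
    (hx : x ∈ Ioc a b) : (x - a) * f x ≤ m := by
  rw [← ENNReal.ofReal_le_ofReal_iff hm]
  refine le_trans ?_ hmass
  rw [dens_apply _ MeasurableSet.univ, univ_inter]
  calc ENNReal.ofReal ((x - a) * f x)
      = ∫⁻ _ in Ioc a x, ENNReal.ofReal (f x) := by
        rw [setLIntegral_const, Real.volume_Ioc, mul_comm, ENNReal.ofReal_mul (hf.nonneg x hx)]
    _ ≤ ∫⁻ y in Ioc a x, ENNReal.ofReal (f y) :=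
        setLIntegral_mono' measurableSet_Ioc fun y hy =>
          ENNReal.ofReal_le_ofReal (hf.anti ⟨hy.1, hy.2.trans hx.2⟩ hx hy.2)
    _ ≤ ∫⁻ y in Ioc 0 1, ENNReal.ofReal (f y) :=
        lintegral_mono_set (Ioc_subset_Ioc ha (hx.2.trans hb))

theorem rpow_div_deriv_left_le {α s y : ℝ} (hα : 0 < α) (hs0 : 0 ≤ s) (hs1 : s ≤ 1)
    (hy : 0 < y) :
    y ^ (-s) / (1 + (1 + α) * (2 ^ α * y ^ α)) ≤ (lsvLeft α y) ^ (-s) *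
      (1 - (1 + α - s) * (2 ^ α * y ^ α) / (1 + (1 + α) * (2 ^ α * y ^ α))) := by
  set t := (2 : ℝ) ^ α * y ^ α with ht
  have ht0 : 0 ≤ t := two_rpow_mul_rpow_nonneg α hy.le
  have h1 : 0 < 1 + t := by positivity
  have hd : 0 < 1 + (1 + α) * t := by positivity
  have hb : (1 + t) ^ s ≤ 1 + s * t := rpow_one_add_le_one_add_mul_self (by linarith) hs0 hs1
  have e1 : y ^ (-s) = (lsvLeft α y) ^ (-s) * (1 + t) ^ s := by
    rw [lsvLeft, Real.mul_rpow hy.le h1.le, mul_assoc, ← Real.rpow_add h1]; simp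
  have e2 : 1 - (1 + α - s) * t / (1 + (1 + α) * t) = (1 + s * t) / (1 + (1 + α) * t) := by
    field_simp; ring
  rw [e1, e2, mul_div_assoc]
  have : 0 ≤ (lsvLeft α y) ^ (-s) := Real.rpow_nonneg (mul_nonneg hy.le h1.le) _
  gcongr

theorem rpow_div_deriv_left_le_rpow {α s y : ℝ} (hα : 0 < α) (hs0 : 0 ≤ s) (hs1 : s ≤ 1)
    (hy : 0 < y) :
    y ^ (-s) / (1 + (1 + α) * (2 ^ α * y ^ α)) ≤ (lsvLeft α y) ^ (-s) := by
  refine (rpow_div_deriv_left_le hα hs0 hs1 hy).trans ?_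
  have ht0 := two_rpow_mul_rpow_nonneg α hy.le
  refine mul_le_of_le_one_right (Real.rpow_nonneg (mul_nonneg hy.le (by linarith)) _) ?_
  have : 0 ≤ (1 + α - s) * (2 ^ α * y ^ α) / (1 + (1 + α) * (2 ^ α * y ^ α)) :=
    div_nonneg (mul_nonneg (by linarith) ht0) (by positivity)
  linarith

theorem lsvLeft_le_two_mul {α y : ℝ} (hα : 0 < α) (hy : y ∈ Ioc (0 : ℝ) (1 / 2)) :
    lsvLeft α y ≤ 2 * y := by
  have := two_rpow_mul_rpow_le_one hα hy.1.le hy.2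
  have := hy.1
  rw [lsvLeft]; nlinarith

theorem le_lsvLeft {α y : ℝ} (hy : 0 < y) : y ≤ lsvLeft α y := by
  have := two_rpow_mul_rpow_nonneg α hy.le
  rw [lsvLeft]; nlinarith

theorem rpow_div_deriv_left_le_sub {α β y : ℝ} (hα : 0 < α) (hα1 : α < 1) (hβ1 : β ≤ 1)
    (hαβ : α < β) (hy : y ∈ Ioc (0 : ℝ) (1 / 2)) :
    y ^ (-α - 1 + β) / (1 + (1 + α) * (2 ^ α * y ^ α)) ≤
      (lsvLeft α y) ^ (-α - 1 + β) - β / 3 * (lsvLeft α y) ^ (-1 + β) := by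
  have h := rpow_div_deriv_left_le (s := α + 1 - β) hα (by linarith) (by linarith) hy.1
  have e : -(α + 1 - β) = -α - 1 + β := by ring
  rw [e] at h
  refine h.trans ?_
  set x := lsvLeft α y with hx
  set t := (2 : ℝ) ^ α * y ^ α with ht
  have hx0 : 0 < x := hy.1.trans_le (le_lsvLeft hy.1)
  have ht0 : 0 ≤ t := two_rpow_mul_rpow_nonneg α hy.1.le
  have ht1 : t ≤ 1 := two_rpow_mul_rpow_le_one hα hy.1.le hy.2
  have hxt : x ^ α ≤ t := by
    rw [ht, ← Real.mul_rpow (by norm_num) hy.1.le]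
    exact Real.rpow_le_rpow hx0.le (lsvLeft_le_two_mul hα hy) hα.le
  have e2 : x ^ (-1 + β) = x ^ (-α - 1 + β) * x ^ α := by
    rw [← Real.rpow_add hx0]; ring_nf
  have hd : 1 + (1 + α) * t ≤ 3 := by nlinarith
  have hd0 : 0 < 1 + (1 + α) * t := by positivity
  have h2 : β / 3 * x ^ α ≤ (1 + α - (α + 1 - β)) * t / (1 + (1 + α) * t) := by
    rw [le_div_iff₀ hd0]
    have hβ : 0 < β := hα.trans hαβ
    have hxa : 0 ≤ x ^ α := Real.rpow_nonneg hx0.le _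
    calc β / 3 * x ^ α * (1 + (1 + α) * t) ≤ β / 3 * t * 3 := by gcongr
      _ = (1 + α - (α + 1 - β)) * t := by ring
  have h3 : 0 ≤ x ^ (-α - 1 + β) := Real.rpow_nonneg hx0.le _
  rw [e2]
  nlinarith

theorem rpow_div_deriv_right_le {K β v : ℝ} (hK : K ∈ Ioo (0 : ℝ) 1) (hβ0 : 0 ≤ β)
    (hv : 0 < v) : v ^ (-1 + β) / (K + 4 * (1 - K) * v) ≤
      K ^ (-β) * (K * v + 2 * (1 - K) * v ^ 2) ^ (-1 + β) := by
  obtain ⟨hK0, hK1⟩ := hK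
  have hK2 : 0 < 1 - K := by linarith
  set c := K + 2 * (1 - K) * v with hc
  have hc0 : 0 < c := by positivity
  have hKc : K ≤ c := by rw [hc]; nlinarith [mul_pos hK2 hv]
  have hcd : c ≤ K + 4 * (1 - K) * v := by rw [hc]; nlinarith [mul_pos hK2 hv]
  have e : K * v + 2 * (1 - K) * v ^ 2 = v * c := by rw [hc]; ring
  rw [e, Real.mul_rpow hv.le hc0.le]
  have hv1 : 0 ≤ v ^ (-1 + β) := Real.rpow_nonneg hv.le _
  have h1 : v ^ (-1 + β) / (K + 4 * (1 - K) * v) ≤ v ^ (-1 + β) / c :=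
    div_le_div_of_nonneg_left hv1 hc0 hcd
  have h2 : c ^ (-β) ≤ K ^ (-β) := Real.rpow_le_rpow_of_nonpos hK0 hKc (by linarith)
  have h3 : v ^ (-1 + β) / c = c ^ (-β) * (v ^ (-1 + β) * c ^ (-1 + β)) := by
    rw [mul_left_comm, ← Real.rpow_add hc0, div_eq_mul_inv, ← Real.rpow_neg_one c]
    ring_nf
  have h4 : 0 ≤ c ^ (-1 + β) := Real.rpow_nonneg hc0.le _
  rw [h3] at h1
  refine h1.trans ?_
  gcongr

/-- The system of LSV maps and maps `R_{α, K}`. -/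
noncomputable def lsvSystem {ι : Type*} [DecidableEq ι] (p α K : ι → ℝ) (SR : Finset ι) :
    System ι where
  p := p
  l j := leftBranch (α j)
  r j := if j ∈ SR then quadraticBranch (K j) else linearBranch

section

variable {ι : Type*} [DecidableEq ι] [Fintype ι] {p α K : ι → ℝ} {SR : Finset ι} {q : ℕ}

theorem lsvSystem_regular (hα : ∀ j, 0 < α j) (hK : ∀ r ∈ SR, K r ∈ Ioo (0 : ℝ) 1)
    (hp : ∀ j, 0 < p j) (hp1 : ∑ j, p j = 1) (hq2 : 2 ≤ q) (hq : ∀ j, 1 + α j ≤ q) :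
    (lsvSystem p α K SR).Regular q where
  p_pos := hp
  p_sum := hp1
  left j := leftBranch_regular (hα j) (hq j)
  right j := by
    simp only [lsvSystem]
    split_ifs with h
    · exact quadraticBranch_regular (hK j h) hq2
    · exact linearBranch_regular q
  left_a _ := rfl
  left_b _ := rfl
  right_a j := by simp only [lsvSystem]; split_ifs <;> rfl
  right_b j := by simp only [lsvSystem]; split_ifs <;> rfl

theorem transfer_left_le_on_right {α m : ℝ} (hα : 0 < α) (hq : 1 + α ≤ q) {f : ℝ → ℝ}
    (hf : InCone q f) (hm : 0 ≤ m) (hmass : dens f univ ≤ ENNReal.ofReal m) {x : ℝ}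
    (hx : x ∈ Ioc (1 / 2 : ℝ) 1) : (leftBranch α).transfer f x ≤ 4 * m := by
  have hB := leftBranch_regular hα hq
  have hx' : x ∈ Ioc (leftBranch α).c (leftBranch α).d :=
    ⟨lt_trans (by norm_num [leftBranch]) hx.1, hx.2⟩
  rw [Branch.Regular.transfer_of_mem hx']
  have hy := hB.inv_mem hx'
  have hxy : lsvLeft α _ = x := hB.map_inv hx'
  set y := (leftBranch α).inv x
  have h1 := sub_mul_le_mass le_rfl (by norm_num) hf.left hm hmass hy
  have h2 := lsvLeft_le_two_mul hα hy
  have h3 := hf.left.nonneg y hy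
  have hd : 1 ≤ (leftBranch α).deriv y := by
    have := two_rpow_mul_rpow_nonneg α (show 0 ≤ y from hy.1.le)
    simp only [leftBranch]
    have : 0 ≤ (1 + α) * (2 ^ α * y ^ α) := by positivity
    linarith
  refine (div_le_self h3 hd).trans ?_
  have := hx.1
  nlinarith

theorem transfer_linear_le_on_right {m : ℝ} {f : ℝ → ℝ}
    (hf : InCone q f) (hm : 0 ≤ m) (hmass : dens f univ ≤ ENNReal.ofReal m) {x : ℝ}
    (hx : x ∈ Ioc (1 / 2 : ℝ) 1) : linearBranch.transfer f x ≤ 4 * m := by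
  have hB := linearBranch_regular q
  have hx' : x ∈ Ioc linearBranch.c linearBranch.d :=
    ⟨lt_trans (by norm_num [linearBranch]) hx.1, hx.2⟩
  rw [Branch.Regular.transfer_of_mem hx']
  have hy := hB.inv_mem hx'
  have hxy : 2 * _ - 1 = x := hB.map_inv hx'
  set y := linearBranch.inv x
  have h1 := sub_mul_le_mass (by norm_num) le_rfl hf.right hm hmass hy
  have h3 := hf.right.nonneg y hy
  change f y / 2 ≤ _
  have := hx.1
  nlinarith

theorem transfer_linear_le_on_left {a β A B : ℝ} {f : ℝ → ℝ} (hβ : 0 < β) (hB0 : 0 ≤ B)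
    (hf : PowerBound a β A B f) {x : ℝ}
    (hx : x ∈ Ioc (0 : ℝ) (1 / 2)) : linearBranch.transfer f x ≤ B * x ^ (-1 + β) := by
  have hB := linearBranch_regular 0
  have hx' : x ∈ Ioc linearBranch.c linearBranch.d := ⟨hx.1, hx.2.trans (by norm_num [linearBranch])⟩
  rw [Branch.Regular.transfer_of_mem hx']
  have hy := hB.inv_mem hx'
  have hxy : 2 * _ - 1 = x := hB.map_inv hx'
  set y := linearBranch.inv x
  change f y / 2 ≤ _
  have h1 := hf.right y hy
  have e : y - 1 / 2 = x * (1 / 2) := by rw [← hxy]; ring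
  rw [e, Real.mul_rpow hx.1.le (by norm_num), Real.rpow_add (by norm_num : (0 : ℝ) < 1 / 2)] at h1
  have h2 : ((1 : ℝ) / 2) ^ (-1 : ℝ) = 2 := by rw [Real.rpow_neg_one]; norm_num
  have h3 : ((1 : ℝ) / 2) ^ β ≤ 1 := Real.rpow_le_one (by norm_num) (by norm_num) hβ.le
  rw [h2] at h1
  have h4 : 0 ≤ B * x ^ (-1 + β) := mul_nonneg hB0 (Real.rpow_nonneg hx.1.le _)
  nlinarith

theorem transfer_quadratic_le_on_right {K a β A B : ℝ} {f : ℝ → ℝ} (hK : K ∈ Ioo (0 : ℝ) 1)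
    (hβ : 0 < β) (hB0 : 0 ≤ B) (hf : PowerBound a β A B f) {x : ℝ}
    (hx : x ∈ Ioc (1 / 2 : ℝ) 1) :
    (quadraticBranch K).transfer f x ≤ K ^ (-β) * (B * (x - 1 / 2) ^ (-1 + β)) := by
  have hB := quadraticBranch_regular hK le_rfl
  have hx' : x ∈ Ioc (quadraticBranch K).c (quadraticBranch K).d := hx
  rw [Branch.Regular.transfer_of_mem hx']
  have hy := hB.inv_mem hx'
  have hxy : 1 / 2 + K * (_ - 1 / 2) + 2 * (1 - K) * (_ - 1 / 2) ^ 2 = x := hB.map_inv hx'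
  have hd := hB.deriv_pos _ hy
  set y := (quadraticBranch K).inv x
  have h1 := div_le_div_of_nonneg_right (hf.right y hy) hd.le
  refine h1.trans ?_
  have h2 : (y - 1 / 2) ^ (-1 + β) / (K + 4 * (1 - K) * (y - 1 / 2)) ≤
      K ^ (-β) * (K * (y - 1 / 2) + 2 * (1 - K) * (y - 1 / 2) ^ 2) ^ (-1 + β) :=
    rpow_div_deriv_right_le hK hβ.le (sub_pos.2 hy.1)
  have e : K * (y - 1 / 2) + 2 * (1 - K) * (y - 1 / 2) ^ 2 = x - 1 / 2 := by rw [← hxy]; ring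
  change B * (y - 1 / 2) ^ (-1 + β) / (K + 4 * (1 - K) * (y - 1 / 2)) ≤ _
  rw [e] at h2
  have h3 := mul_le_mul_of_nonneg_left h2 hB0
  rw [mul_div_assoc]
  linarith

theorem transfer_left_le_on_left {α a β A B : ℝ} {f : ℝ → ℝ} (hα : 0 < α) (ha : 0 < a)
    (hβ1 : β ≤ 1) (haβ : a < β) (hA0 : 0 ≤ A) (hf : PowerBound a β A B f) {x : ℝ}
    (hx : x ∈ Ioc (0 : ℝ) (1 / 2)) :
    (leftBranch α).transfer f x ≤ A * x ^ (-a - 1 + β) := by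
  obtain ⟨q, hq⟩ := exists_nat_ge (1 + α)
  have hB := leftBranch_regular hα hq
  have hx' : x ∈ Ioc (leftBranch α).c (leftBranch α).d :=
    ⟨hx.1, hx.2.trans (by norm_num [leftBranch])⟩
  rw [Branch.Regular.transfer_of_mem hx']
  have hy := hB.inv_mem hx'
  have hxy : lsvLeft α _ = x := hB.map_inv hx'
  have hd := hB.deriv_pos _ hy
  set y := (leftBranch α).inv x
  refine (div_le_div_of_nonneg_right (hf.left y hy) hd.le).trans ?_
  have h2 := rpow_div_deriv_left_le_rpow (s := a + 1 - β) hα (by linarith) (by linarith)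
    (show 0 < y from hy.1)
  have e : -(a + 1 - β) = -a - 1 + β := by ring
  rw [hxy, e] at h2
  have h3 := mul_le_mul_of_nonneg_left h2 hA0
  rwa [← mul_div_assoc] at h3

theorem transfer_left_le_sub_on_left {α β A B : ℝ} {f : ℝ → ℝ} (hα : 0 < α) (hα1 : α < 1)
    (hβ1 : β ≤ 1) (haβ : α < β) (hA0 : 0 ≤ A) (hf : PowerBound α β A B f) {x : ℝ}
    (hx : x ∈ Ioc (0 : ℝ) (1 / 2)) : (leftBranch α).transfer f x ≤
      A * x ^ (-α - 1 + β) - β / 3 * A * x ^ (-1 + β) := by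
  obtain ⟨q, hq⟩ := exists_nat_ge (1 + α)
  have hB := leftBranch_regular hα hq
  have hx' : x ∈ Ioc (leftBranch α).c (leftBranch α).d :=
    ⟨hx.1, hx.2.trans (by norm_num [leftBranch])⟩
  rw [Branch.Regular.transfer_of_mem hx']
  have hy := hB.inv_mem hx'
  have hxy : lsvLeft α _ = x := hB.map_inv hx'
  have hd := hB.deriv_pos _ hy
  set y := (leftBranch α).inv x
  refine (div_le_div_of_nonneg_right (hf.left y hy) hd.le).trans ?_
  have h2 := rpow_div_deriv_left_le_sub hα hα1 hβ1 haβ hy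
  rw [hxy] at h2
  have h3 := mul_le_mul_of_nonneg_left h2 hA0
  rw [mul_div_assoc]
  refine h3.trans (le_of_eq ?_)
  ring

theorem powerBound_op {αmin β m A B : ℝ} {f : ℝ → ℝ} (hα : ∀ j, 0 < α j)
    (hK : ∀ r ∈ SR, K r ∈ Ioo (0 : ℝ) 1) (hp : ∀ j, 0 < p j) (hp1 : ∑ j, p j = 1)
    (hq : ∀ j, 1 + α j ≤ q) {j₀ : ι} (hj₀ : α j₀ = αmin) (hα1 : αmin < 1)
    (hβ : αmin < β) (hβ1 : β ≤ 1) (hf : InCone q f) (hm : 0 ≤ m)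
    (hmass : dens f univ ≤ ENNReal.ofReal m) (hA : 0 ≤ A) (hB : 0 ≤ B)
    (hmB : 8 * m ≤ (1 - ∑ r ∈ SR, p r * K r ^ (-β)) * B) (hBA : 3 * B ≤ p j₀ * β * A)
    (hb : PowerBound αmin β A B f) :
    PowerBound αmin β A B ((lsvSystem p α K SR).op f) := by
  have hα0 : 0 < αmin := hj₀ ▸ hα j₀
  have hβ0 : 0 < β := hα0.trans hβ
  constructor
  · intro x hx
    have hx1 : 0 ≤ x ^ (-1 + β) := Real.rpow_nonneg hx.1.le _
    have hterm : ∀ j, p j * ((leftBranch (α j)).transfer f x +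
        (if j ∈ SR then quadraticBranch (K j) else linearBranch).transfer f x) ≤
        p j * (A * x ^ (-αmin - 1 + β) + B * x ^ (-1 + β)) -
          if j = j₀ then p j₀ * (β / 3 * A * x ^ (-1 + β)) else 0 := by
      intro j
      have h1 : (if j ∈ SR then quadraticBranch (K j) else linearBranch).transfer f x ≤
          B * x ^ (-1 + β) := by
        split_ifs
        · rw [Branch.Regular.transfer_of_notMem fun h => absurd h.1 (not_lt.2 hx.2)]
          positivity
        · exact transfer_linear_le_on_left hβ0 hB hb hx
      by_cases hj : j = j₀
      · rw [if_pos hj]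
        subst hj
        subst hj₀
        have h2 := transfer_left_le_sub_on_left (hα j) hα1 hβ1 hβ hA hb hx
        have := hp j
        rw [← mul_sub]
        exact mul_le_mul_of_nonneg_left (by linarith) this.le
      · have h2 := transfer_left_le_on_left (hα j) hα0 hβ1 hβ hA hb hx
        rw [if_neg hj, sub_zero]
        exact mul_le_mul_of_nonneg_left (by linarith) (hp j).le
    refine (Finset.sum_le_sum fun j _ => hterm j).trans ?_
    rw [Finset.sum_sub_distrib, ← Finset.sum_mul, hp1, Finset.sum_ite_eq' Finset.univ j₀,
      if_pos (Finset.mem_univ _)]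
    nlinarith [mul_le_mul_of_nonneg_right hBA hx1]
  · intro x hx
    have hu : 0 < x - 1 / 2 := sub_pos.2 hx.1
    have hu1 : 1 ≤ (x - 1 / 2) ^ (-1 + β) :=
      Real.one_le_rpow_of_pos_of_le_one_of_nonpos hu (by linarith [hx.2]) (by linarith)
    set U := (x - 1 / 2) ^ (-1 + β) with hU
    have hterm : ∀ j, p j * ((leftBranch (α j)).transfer f x +
        (if j ∈ SR then quadraticBranch (K j) else linearBranch).transfer f x) ≤
        p j * (8 * m) + if j ∈ SR then p j * K j ^ (-β) * (B * U) else 0 := by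
      intro j
      have h2 := transfer_left_le_on_right (hα j) (hq j) hf hm hmass hx
      split_ifs with hj
      · have h1 := transfer_quadratic_le_on_right (hK j hj) hβ0 hB hb hx
        rw [mul_assoc, ← mul_add]
        exact mul_le_mul_of_nonneg_left (by linarith) (hp j).le
      · have h1 := transfer_linear_le_on_right hf hm hmass hx
        rw [add_zero]
        exact mul_le_mul_of_nonneg_left (by linarith) (hp j).le
    refine (Finset.sum_le_sum fun j _ => hterm j).trans ?_
    rw [Finset.sum_add_distrib, ← Finset.sum_mul, hp1, Finset.sum_ite_mem, Finset.univ_inter,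
      ← Finset.sum_mul]
    nlinarith [mul_le_mul_of_nonneg_right hmB (zero_le_one.trans hu1)]

end

open Filter Topology

theorem PieceCone.cauchySeq {q : ℕ} {a b : ℝ} {F : ℕ → ℝ → ℝ} {C : ℝ → ℝ}
    (hF : ∀ n, PieceCone q a b (F n)) (hC : ∀ n, ∀ x ∈ Ioc a b, F n x ≤ C x)
    (hQ : ∀ r : ℚ, (r : ℝ) ∈ Ioc a b → CauchySeq fun n => F n r) {x : ℝ} (hx : x ∈ Ioc a b) :
    CauchySeq fun n => F n x := by
  obtain ⟨z, haz, hzx⟩ := exists_between hx.1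
  have hz : z ∈ Ioc a b := ⟨haz, hzx.le.trans hx.2⟩
  have hqz : 0 ≤ (q : ℝ) / (z - a) := div_nonneg (by positivity) (by linarith)
  set D := C z * (q / (z - a)) with hD
  have hD0 : 0 ≤ D := mul_nonneg (((hF 0).nonneg z hz).trans (hC 0 z hz)) hqz
  refine Metric.cauchySeq_iff.2 fun ε hε => ?_
  have hδ : 0 < ε / (3 * (D + 1)) := by positivity
  obtain ⟨r, hr1, hr2⟩ := exists_rat_btwn (max_lt hzx (sub_lt_self x hδ))
  obtain ⟨hr3, hr4⟩ := max_lt_iff.1 hr1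
  have hr : (r : ℝ) ∈ Ioc a b := ⟨haz.trans hr3, hr2.le.trans hx.2⟩
  have hclose : ∀ n, |F n x - F n r| < ε / 3 := by
    intro n
    have h1 := (hF n).abs_sub_le haz ⟨hzx.le, hx.2⟩ ⟨hr3.le, hr.2⟩
    rw [abs_of_pos (sub_pos.2 hr2)] at h1
    have h2 : F n z * (q / (z - a)) ≤ D := mul_le_mul_of_nonneg_right (hC n z hz) hqz
    have h3 : x - r < ε / (3 * (D + 1)) := by linarith
    rw [lt_div_iff₀ (by positivity)] at h3
    have h4 := mul_le_mul_of_nonneg_right h2 (sub_pos.2 hr2).le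
    nlinarith
  obtain ⟨M, hM⟩ := Metric.cauchySeq_iff.1 (hQ r hr) (ε / 3) (by positivity)
  refine ⟨M, fun m hm n hn => ?_⟩
  have h1 := hM m hm n hn
  have h2 := hclose m
  have h3 := hclose n
  rw [Real.dist_eq] at *
  rw [abs_lt] at *
  constructor <;> linarith [h1.1, h1.2, h2.1, h2.2, h3.1, h3.2]

/-- Pointwise bounded sequences in the cone have pointwise convergent subsequences. -/
theorem InCone.exists_subseq_tendsto {q : ℕ} {F : ℕ → ℝ → ℝ} {C : ℝ → ℝ}
    (hF : ∀ n, InCone q (F n)) (hC : ∀ n, ∀ x ∈ Ioc (0 : ℝ) 1, F n x ≤ C x) :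
    ∃ φ : ℕ → ℕ, StrictMono φ ∧ ∃ h : ℝ → ℝ,
      ∀ x ∈ Ioc (0 : ℝ) 1, Tendsto (fun n => F (φ n) x) atTop (𝓝 (h x)) := by
  have hK : IsCompact (Set.pi univ fun r : ℚ => Icc 0 |C r|) :=
    isCompact_univ_pi fun r => isCompact_Icc
  have hu : ∀ n, (fun r : ℚ => (Ioc (0 : ℝ) 1).indicator (F n) r) ∈
      Set.pi univ fun r : ℚ => Icc 0 |C r| := by
    intro n r _
    by_cases hr : (r : ℝ) ∈ Ioc (0 : ℝ) 1
    · simp only [indicator_of_mem hr]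
      exact ⟨(hF n).nonneg hr, (hC n r hr).trans (le_abs_self _)⟩
    · simp only [indicator_of_notMem hr]
      exact ⟨le_rfl, abs_nonneg _⟩
  obtain ⟨l, -, φ, hφ, hl⟩ := hK.tendsto_subseq hu
  refine ⟨φ, hφ, ?_⟩
  have hQ : ∀ r : ℚ, (r : ℝ) ∈ Ioc (0 : ℝ) 1 → CauchySeq fun n => F (φ n) r := by
    intro r hr
    have h1 := (tendsto_pi_nhds.1 hl r).cauchySeq
    simpa only [Function.comp_def, indicator_of_mem hr] using h1
  have hx : ∀ x ∈ Ioc (0 : ℝ) 1, CauchySeq fun n => F (φ n) x := by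
    intro x hx
    rcases mem_halves hx with hx | hx
    · have hsub : Ioc (0 : ℝ) (1 / 2) ⊆ Ioc 0 1 := Ioc_subset_Ioc le_rfl (by norm_num)
      exact PieceCone.cauchySeq (fun n => (hF (φ n)).left) (fun n x hx => hC _ x (hsub hx))
        (fun r hr => hQ r (hsub hr)) hx
    · have hsub : Ioc (1 / 2 : ℝ) 1 ⊆ Ioc 0 1 := Ioc_subset_Ioc (by norm_num) le_rfl
      exact PieceCone.cauchySeq (fun n => (hF (φ n)).right) (fun n x hx => hC _ x (hsub hx))
        (fun r hr => hQ r (hsub hr)) hx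
  refine ⟨fun x => limUnder atTop fun n => F (φ n) x, fun x h => (hx x h).tendsto_limUnder⟩

/-- The function dominating all functions with a given power bound. -/
noncomputable def powerMajorant (α β A B x : ℝ) : ℝ :=
  if x ≤ 1 / 2 then A * x ^ (-α - 1 + β) else B * (x - 1 / 2) ^ (-1 + β)

theorem PowerBound.le_majorant {α β A B : ℝ} {f : ℝ → ℝ} (hf : PowerBound α β A B f) {x : ℝ}
    (hx : x ∈ Ioc (0 : ℝ) 1) : f x ≤ powerMajorant α β A B x := by
  rw [powerMajorant]
  split_ifs with h
  · exact hf.left x ⟨hx.1, h⟩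
  · exact hf.right x ⟨not_le.1 h, hx.2⟩

theorem integrableOn_powerMajorant {α β A B : ℝ} (hα : 0 < α) (hβ : α < β) :
    IntegrableOn (powerMajorant α β A B) (Ioc 0 1) := by
  rw [← union_halves]
  refine IntegrableOn.union ?_ ?_
  · have h : IntegrableOn (fun x : ℝ => A * x ^ (-α - 1 + β)) (Ioc 0 (1 / 2)) := by
      rw [← intervalIntegrable_iff_integrableOn_Ioc_of_le (by norm_num)]
      exact (intervalIntegral.intervalIntegrable_rpow' (by linarith)).const_mul _
    exact h.congr_fun (fun x hx => (if_pos hx.2).symm) measurableSet_Ioc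
  · have h : IntegrableOn (fun x : ℝ => B * (x - 1 / 2) ^ (-1 + β)) (Ioc (1 / 2) 1) := by
      rw [← intervalIntegrable_iff_integrableOn_Ioc_of_le (by norm_num)]
      have h1 : IntervalIntegrable (fun x : ℝ => x ^ (-1 + β)) volume 0 (1 / 2) :=
        intervalIntegral.intervalIntegrable_rpow' (by linarith)
      have h2 := h1.comp_sub_right (1 / 2)
      norm_num at h2 ⊢
      exact h2.const_mul _
    exact h.congr_fun (fun x hx => (if_neg (not_le.2 hx.1)).symm) measurableSet_Ioc

/-- Pointwise limits of cone functions with a common power bound are limits of measures. -/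
theorem tendsto_dens {q : ℕ} {α β A B : ℝ} (hα : 0 < α) (hβ : α < β) {F : ℕ → ℝ → ℝ} {h : ℝ → ℝ}
    (hF : ∀ n, InCone q (F n)) (hb : ∀ n, PowerBound α β A B (F n))
    (hlim : ∀ x ∈ Ioc (0 : ℝ) 1, Tendsto (fun n => F n x) atTop (𝓝 (h x)))
    {E : Set ℝ} (hE : MeasurableSet E) :
    Tendsto (fun n => dens (F n) E) atTop (𝓝 (dens h E)) := by
  simp only [dens_apply _ hE]
  have hm : ∀ᵐ x ∂volume.restrict (E ∩ Ioc (0 : ℝ) 1), x ∈ Ioc (0 : ℝ) 1 :=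
    (ae_restrict_mem (hE.inter measurableSet_Ioc)).mono fun x hx => hx.2
  refine tendsto_lintegral_of_dominated_convergence'
    (fun x => ENNReal.ofReal (powerMajorant α β A B x)) (fun n => ?_) (fun n => ?_) ?_ ?_
  · exact ((hF n).aemeasurable.mono_measure
      (Measure.restrict_mono inter_subset_right le_rfl)).ennreal_ofReal
  · exact hm.mono fun x hx => ENNReal.ofReal_le_ofReal ((hb n).le_majorant hx)
  · have := (integrableOn_powerMajorant (A := A) (B := B) hα hβ).mono_set
      (inter_subset_right (s := E))
    exact this.lintegral_lt_top.ne
  · exact hm.mono fun x hx => ENNReal.tendsto_ofReal (hlim x hx)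

theorem PowerBound.of_tendsto {α β A B : ℝ} {F : ℕ → ℝ → ℝ} {h : ℝ → ℝ}
    (hb : ∀ n, PowerBound α β A B (F n))
    (hlim : ∀ x ∈ Ioc (0 : ℝ) 1, Tendsto (fun n => F n x) atTop (𝓝 (h x))) :
    PowerBound α β A B h where
  left x hx := le_of_tendsto' (hlim x ⟨hx.1, hx.2.trans (by norm_num)⟩) fun n => (hb n).left x hx
  right x hx := le_of_tendsto' (hlim x ⟨lt_trans (by norm_num) hx.1, hx.2⟩)
    fun n => (hb n).right x hx

theorem PowerBound.of_le_const {α β A B C : ℝ} {f : ℝ → ℝ} (hα : 0 < α) (hβ : β ≤ 1)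
    (hC : 0 ≤ C) (hA : C ≤ A) (hB : C ≤ B) (hf : ∀ x ∈ Ioc (0 : ℝ) 1, f x ≤ C) :
    PowerBound α β A B f where
  left x hx := by
    have hx1 : x ≤ 1 := hx.2.trans (by norm_num)
    have h1 := Real.one_le_rpow_of_pos_of_le_one_of_nonpos (z := -α - 1 + β) hx.1 hx1 (by linarith)
    have := hf x ⟨hx.1, hx1⟩
    nlinarith
  right x hx := by
    have h1 := Real.one_le_rpow_of_pos_of_le_one_of_nonpos (z := -1 + β) (sub_pos.2 hx.1)
      (by linarith [hx.2]) (by linarith)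
    have := hf x ⟨lt_trans (by norm_num) hx.1, hx.2⟩
    nlinarith

/-- Averages of a sequence of functions. -/
noncomputable def average (F : ℕ → ℝ → ℝ) (n : ℕ) (x : ℝ) : ℝ :=
  (n + 1 : ℝ)⁻¹ * ∑ k ∈ Finset.range (n + 1), F k x

theorem average_le {F : ℕ → ℝ → ℝ} {n : ℕ} {x c : ℝ} (h : ∀ k, F k x ≤ c) :
    average F n x ≤ c := by
  have hn : (0 : ℝ) < n + 1 := by positivity
  rw [average, inv_mul_le_iff₀ hn]
  refine (Finset.sum_le_card_nsmul _ _ c fun k _ => h k).trans ?_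
  simp

theorem InCone.average {q : ℕ} {F : ℕ → ℝ → ℝ} (hF : ∀ k, InCone q (F k)) (n : ℕ) :
    InCone q (LSV.average F n) :=
  (InCone.sum _ fun k _ => hF k).const_mul (by positivity)

theorem PowerBound.average {α β A B : ℝ} {F : ℕ → ℝ → ℝ} (hF : ∀ k, PowerBound α β A B (F k))
    (n : ℕ) : PowerBound α β A B (LSV.average F n) where
  left x hx := average_le fun k => (hF k).left x hx
  right x hx := average_le fun k => (hF k).right x hx

theorem dens_const_mul {f : ℝ → ℝ} {c : ℝ} (hc : 0 ≤ c) (E : Set ℝ) (hE : MeasurableSet E) :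
    dens (fun x => c * f x) E = ENNReal.ofReal c * dens f E := by
  simp only [dens_apply _ hE, ENNReal.ofReal_mul hc]
  exact lintegral_const_mul' _ _ ENNReal.ofReal_ne_top

theorem dens_add {q : ℕ} {f g : ℝ → ℝ} (hf : InCone q f) (hg : InCone q g) :
    dens (fun x => f x + g x) = dens f + dens g := by
  ext E hE
  rw [Measure.add_apply, dens_apply _ hE, dens_apply _ hE, dens_apply _ hE, ← lintegral_add_left'
    (hf.aemeasurable.mono_measure
      (Measure.restrict_mono inter_subset_right le_rfl)).ennreal_ofReal]
  refine setLIntegral_congr_fun (hE.inter measurableSet_Ioc) fun x hx => ?_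
  exact ENNReal.ofReal_add (hf.nonneg hx.2) (hg.nonneg hx.2)

theorem dens_average {q : ℕ} {F : ℕ → ℝ → ℝ} (hF : ∀ k, InCone q (F k)) (n : ℕ) {E : Set ℝ}
    (hE : MeasurableSet E) : dens (average F n) E =
      ENNReal.ofReal (n + 1 : ℝ)⁻¹ * ∑ k ∈ Finset.range (n + 1), dens (F k) E := by
  have h : ∀ m, dens (fun x => ∑ k ∈ Finset.range m, F k x) E =
      ∑ k ∈ Finset.range m, dens (F k) E := by
    intro m
    induction m with
    | zero => simp [dens_apply _ hE]
    | succ m ih =>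
      simp only [Finset.sum_range_succ]
      rw [dens_add (InCone.sum _ fun k _ => hF k) (hF m), Measure.add_apply, ih]
  rw [← h]
  exact dens_const_mul (by positivity) E hE

namespace System.Regular

variable {ι : Type*} [Fintype ι] {S : System ι} {q : ℕ} {α β A B : ℝ} {f h h₁ h₂ : ℝ → ℝ}

theorem tendsto_op_average_sub {C : ℝ → ℝ} (hS : S.Regular q) (hf : InCone q f)
    (hC : ∀ k, ∀ x ∈ Ioc (0 : ℝ) 1, S.op^[k] f x ≤ C x) {x : ℝ} (hx : x ∈ Ioc (0 : ℝ) 1) :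
    Tendsto (fun n => S.op (average (fun k => S.op^[k] f) n) x -
      average (fun k => S.op^[k] f) n x) atTop (𝓝 0) := by
  have e : ∀ n, S.op (average (fun k => S.op^[k] f) n) x - average (fun k => S.op^[k] f) n x =
      1 / (n + 1 : ℝ) * (S.op^[n + 1] f x - f x) := by
    intro n
    have h1 : S.op (average (fun k => S.op^[k] f) n) x =
        (n + 1 : ℝ)⁻¹ * ∑ k ∈ Finset.range (n + 1), S.op^[k + 1] f x := by
      simp only [Function.iterate_succ_apply']
      rw [← op_sum, ← op_const_mul]
      rfl
    rw [h1, average, ← mul_sub, ← Finset.sum_sub_distrib,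
      Finset.sum_range_sub (fun k => S.op^[k] f x), one_div]
    rfl
  refine squeeze_zero_norm (a := fun n : ℕ => 1 / (n + 1 : ℝ) * C x) (fun n => ?_) ?_
  · have hn : 0 ≤ 1 / (n + 1 : ℝ) := by positivity
    rw [e, norm_mul, Real.norm_of_nonneg hn]
    refine mul_le_mul_of_nonneg_left ?_ hn
    have h1 := (hS.inCone_iterate hf (n + 1)).nonneg hx
    have h2 := hC (n + 1) x hx
    have h3 := hf.nonneg hx
    have h4 : f x ≤ C x := hC 0 x hx
    rw [Real.norm_eq_abs, abs_le]
    constructor <;> linarith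
  · simpa using (tendsto_one_div_add_atTop_nhds_zero_nat (𝕜 := ℝ)).mul_const (C x)

/-- Cesàro averages of orbits with uniform power bounds accumulate at fixed densities. -/
theorem exists_fixed_limit (hS : S.Regular q) (hα : 0 < α) (hβ : α < β) (hf : InCone q f)
    (hb : ∀ k, PowerBound α β A B (S.op^[k] f)) {ψ : ℕ → ℕ} (hψ : StrictMono ψ) :
    ∃ φ : ℕ → ℕ, StrictMono φ ∧ ∃ h : ℝ → ℝ, InCone q h ∧ PowerBound α β A B h ∧
      (∀ x ∈ Ioc (0 : ℝ) 1, S.op h x = h x) ∧ ∀ E, MeasurableSet E →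
        Tendsto (fun n => dens (average (fun k => S.op^[k] f) (ψ (φ n))) E) atTop
          (𝓝 (dens h E)) := by
  set u := average (fun k => S.op^[k] f) with hu
  have huc : ∀ n, InCone q (u n) := InCone.average fun k => hS.inCone_iterate hf k
  have hub : ∀ n, PowerBound α β A B (u n) := PowerBound.average hb
  obtain ⟨φ, hφ, h, hlim⟩ := InCone.exists_subseq_tendsto (fun n => huc (ψ n))
    fun n x hx => (hub (ψ n)).le_majorant hx
  refine ⟨φ, hφ, h, InCone.of_tendsto (fun n => huc _) hlim, PowerBound.of_tendsto
    (fun n => hub _) hlim, fun x hx => ?_, fun E hE => tendsto_dens hα hβ (fun n => huc _)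
    (fun n => hub _) hlim hE⟩
  have h1 := (hS.tendsto_op hlim x).sub (hlim x hx)
  have h2 := (hS.tendsto_op_average_sub hf (fun k x hx => (hb k).le_majorant hx) hx).comp
    (hψ.comp hφ).tendsto_atTop
  exact sub_eq_zero.1 (tendsto_nhds_unique h1 h2)

end System.Regular

theorem InCone.eq_of_le_of_dens_le {q : ℕ} {f g : ℝ → ℝ} (hf : InCone q f) (hg : InCone q g)
    (hfg : ∀ x ∈ Ioc (0 : ℝ) 1, f x ≤ g x) (hfin : dens f univ ≠ ⊤)
    (hle : dens g univ ≤ dens f univ) : ∀ x ∈ Ioc (0 : ℝ) 1, f x = g x := by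
  simp only [dens_apply _ MeasurableSet.univ, univ_inter] at hfin hle
  have hmem : ∀ᵐ x ∂volume.restrict (Ioc (0 : ℝ) 1), x ∈ Ioc (0 : ℝ) 1 :=
    ae_restrict_mem measurableSet_Ioc
  have h := ae_eq_of_ae_le_of_lintegral_le
    (hmem.mono fun x hx => ENNReal.ofReal_le_ofReal (hfg x hx)) hfin
    hg.aemeasurable.ennreal_ofReal hle
  refine hf.eqOn_of_ae_eq hg ?_
  filter_upwards [h, hmem] with x hx hm
  exact (ENNReal.ofReal_eq_ofReal_iff (hf.nonneg hm) (hg.nonneg hm)).1 hx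

theorem dens_univ_max_ne_top {q : ℕ} {f g : ℝ → ℝ} (hf : InCone q f) (hg : InCone q g)
    (hf' : dens f univ ≠ ⊤) (hg' : dens g univ ≠ ⊤) :
    dens (fun x => max (f x) (g x)) univ ≠ ⊤ := by
  refine ne_top_of_le_ne_top (b := dens (fun x => f x + g x) univ) ?_
    (Measure.le_iff'.1 (dens_mono fun x hx => ?_) univ)
  · rw [dens_add hf hg, Measure.add_apply]
    exact ENNReal.add_ne_top.2 ⟨hf', hg'⟩
  · exact max_le (le_add_of_nonneg_right (hg.nonneg hx)) (le_add_of_nonneg_left (hf.nonneg hx))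

section

variable {D : ℝ → ℝ} {α : ℝ}

/-- The open interval `(a, b) ⊆ (0, 1]` consists of points where `D` is positive. -/
structure IsPosInterval (D : ℝ → ℝ) (a b : ℝ) : Prop where
  nonneg : 0 ≤ a
  lt : a < b
  le_one : b ≤ 1
  ne : ∀ x ∈ Ioo a b, D x ≠ 0

theorem IsPosInterval.double {a b : ℝ} (h : IsPosInterval D a b) (ha : 1 / 2 ≤ a)
    (hright : ∀ y ∈ Ioo (1 / 2 : ℝ) 1, D (2 * y - 1) = 0 → D y = 0) :
    IsPosInterval D (2 * a - 1) (2 * b - 1) where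
  nonneg := by linarith
  lt := by linarith [h.lt]
  le_one := by linarith [h.le_one]
  ne x hx h0 := by
    have hy : (x + 1) / 2 ∈ Ioo a b := ⟨by linarith [hx.1], by linarith [hx.2]⟩
    refine h.ne _ hy (hright _ ⟨by linarith [hy.1], by linarith [hy.2, h.le_one]⟩ ?_)
    rw [show 2 * ((x + 1) / 2) - 1 = x by ring, h0]

theorem sub_le_lsvLeft_sub (hα : 0 < α) {a b : ℝ} (ha : 0 ≤ a) (hab : a ≤ b) :
    b - a ≤ lsvLeft α b - lsvLeft α a := by
  have h1 : a ^ α ≤ b ^ α := Real.rpow_le_rpow ha hab hα.le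
  have h2 : 0 ≤ a ^ α := Real.rpow_nonneg ha _
  have h3 : (0 : ℝ) < 2 ^ α := by positivity
  have h4 : a * (2 ^ α * a ^ α) ≤ b * (2 ^ α * b ^ α) := by gcongr; exact ha.trans hab
  rw [lsvLeft, lsvLeft]; linarith

theorem IsPosInterval.lsvLeft (hα : 0 < α) {a b : ℝ} (h : IsPosInterval D a b) (hb : b ≤ 1 / 2)
    (hleft : ∀ y ∈ Ioc (0 : ℝ) (1 / 2), D (lsvLeft α y) = 0 → D y = 0) :
    IsPosInterval D (lsvLeft α a) (lsvLeft α b) where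
  nonneg := by
    have := two_rpow_mul_rpow_nonneg α h.nonneg
    have := h.nonneg
    unfold _root_.lsvLeft; positivity
  lt := by linarith [sub_le_lsvLeft_sub hα h.nonneg h.lt.le, h.lt]
  le_one := by
    have := lsvLeft_le_two_mul hα ⟨h.nonneg.trans_lt h.lt, hb⟩
    linarith
  ne x hx h0 := by
    obtain ⟨y, hy, rfl⟩ := intermediate_value_Ioo h.lt.le (continuous_lsvLeft hα).continuousOn hx
    exact h.ne y hy (hleft y ⟨h.nonneg.trans_lt hy.1, hy.2.le.trans hb⟩ h0)

theorem IsPosInterval.half_notMem {a b : ℝ} (h : IsPosInterval D a b) (hhalf : D (1 / 2) = 0) :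
    b ≤ 1 / 2 ∨ 1 / 2 ≤ a := by
  by_contra! hc
  exact h.ne _ ⟨hc.2, hc.1⟩ hhalf

theorem IsPosInterval.exists_half_le (hα : 0 < α) {a b : ℝ} (h : IsPosInterval D a b)
    (hhalf : D (1 / 2) = 0)
    (hleft : ∀ y ∈ Ioc (0 : ℝ) (1 / 2), D (_root_.lsvLeft α y) = 0 → D y = 0) :
    ∃ a' b', IsPosInterval D a' b' ∧ b - a ≤ b' - a' ∧ 1 / 2 ≤ a' := by
  by_contra! hc
  have hb0 : 0 < b := h.nonneg.trans_lt h.lt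
  set r := 1 + (2 : ℝ) ^ α * b ^ α with hr
  have hr1 : 1 < r := by rw [hr]; have : 0 < (2 : ℝ) ^ α * b ^ α := by positivity
                         linarith
  have hiter : ∀ n : ℕ, ∃ a' b', IsPosInterval D a' b' ∧ b - a ≤ b' - a' ∧ b * r ^ n ≤ b' := by
    intro n
    induction n with
    | zero => exact ⟨a, b, h, le_rfl, by simp⟩
    | succ n ih =>
      obtain ⟨a', b', h', hlen, hbn⟩ := ih
      have hb' := (h'.half_notMem hhalf).resolve_right (not_le.2 (hc a' b' h' hlen))
      refine ⟨_, _, h'.lsvLeft hα hb' hleft,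
        hlen.trans (sub_le_lsvLeft_sub hα h'.nonneg h'.lt.le), ?_⟩
      have h1 : b ≤ b' := (le_mul_of_one_le_right hb0.le (one_le_pow₀ hr1.le)).trans hbn
      have h2 : r ≤ 1 + 2 ^ α * b' ^ α := by rw [hr]; gcongr
      rw [_root_.lsvLeft, pow_succ, ← mul_assoc]
      exact mul_le_mul hbn h2 (by linarith) (hb0.le.trans h1)
  obtain ⟨n, hn⟩ := pow_unbounded_of_one_lt (1 / b) hr1
  obtain ⟨a', b', h', -, hbn⟩ := hiter n
  rw [div_lt_iff₀ hb0] at hn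
  linarith [h'.le_one]

theorem not_isPosInterval (hα : 0 < α) (hhalf : D (1 / 2) = 0)
    (hleft : ∀ y ∈ Ioc (0 : ℝ) (1 / 2), D (_root_.lsvLeft α y) = 0 → D y = 0)
    (hright : ∀ y ∈ Ioo (1 / 2 : ℝ) 1, D (2 * y - 1) = 0 → D y = 0) {a b : ℝ} :
    ¬ IsPosInterval D a b := by
  intro h
  have hiter : ∀ n : ℕ, ∃ a' b', IsPosInterval D a' b' ∧ (b - a) * 2 ^ n ≤ b' - a' := by
    intro n
    induction n with
    | zero => exact ⟨a, b, h, by simp⟩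
    | succ n ih =>
      obtain ⟨a', b', h', hlen⟩ := ih
      obtain ⟨a'', b'', h'', hlen', ha⟩ := h'.exists_half_le hα hhalf hleft
      refine ⟨_, _, h''.double ha hright, ?_⟩
      rw [pow_succ]; linarith
  have hab := sub_pos.2 h.lt
  obtain ⟨n, hn⟩ := pow_unbounded_of_one_lt (1 / (b - a)) one_lt_two
  obtain ⟨a', b', h', hlen⟩ := hiter n
  rw [div_lt_iff₀ hab] at hn
  linarith [h'.le_one, h'.nonneg]

theorem exists_isPosInterval {a b x : ℝ} (ha : 0 ≤ a) (hb : b ≤ 1) (hD : ContinuousOn D (Ioc a b))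
    (hx : x ∈ Ioo a b) (h0 : D x ≠ 0) : ∃ c d, IsPosInterval D c d := by
  have h1 : ∀ᶠ y in 𝓝 x, D y ≠ 0 :=
    (hD.continuousAt (mem_of_superset (Ioo_mem_nhds hx.1 hx.2) Ioo_subset_Ioc_self)).eventually_ne h0
  obtain ⟨c, d, hcd, hsub⟩ := mem_nhds_iff_exists_Ioo_subset.1
    (h1.and (Ioo_mem_nhds hx.1 hx.2))
  have hlt : c < d := hcd.1.trans hcd.2
  refine ⟨max a c, min b d, ha.trans (le_max_left _ _), ?_, (min_le_left _ _).trans hb,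
    fun y hy => (hsub ⟨(le_max_right _ _).trans_lt hy.1, hy.2.trans_le (min_le_right _ _)⟩).1⟩
  exact (max_lt hx.1 hcd.1).trans (lt_min hx.2 hcd.2)

end

section

variable {ι : Type*} [DecidableEq ι] [Fintype ι] {p α K : ι → ℝ} {SR : Finset ι} {q : ℕ}
  {D h h₁ h₂ : ℝ → ℝ}

omit [Fintype ι] in
theorem lsvSystem_map_of_le (j : ι) {y : ℝ} (hy : y ≤ 1 / 2) :
    (lsvSystem p α K SR).map j y = lsvLeft (α j) y := if_pos hy

omit [Fintype ι] in
theorem lsvSystem_map_of_lt {j : ι} (hj : j ∉ SR) {y : ℝ} (hy : 1 / 2 < y) :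
    (lsvSystem p α K SR).map j y = 2 * y - 1 := by
  rw [System.map, if_neg (not_le.2 hy)]
  simp only [lsvSystem, if_neg hj]
  rfl

/-- A nonnegative piecewise continuous fixed function vanishing at `1` vanishes. -/
theorem eq_zero_of_fixed (hS : (lsvSystem p α K SR).Regular q) {j : ι} (hj : j ∉ SR)
    (hα : 0 < α j) (hD : ∀ x ∈ Ioc (0 : ℝ) 1, 0 ≤ D x)
    (hl : ContinuousOn D (Ioc 0 (1 / 2))) (hr : ContinuousOn D (Ioc (1 / 2) 1))
    (hfix : ∀ x ∈ Ioc (0 : ℝ) 1, (lsvSystem p α K SR).op D x = D x) (h1 : D 1 = 0) :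
    ∀ x ∈ Ioc (0 : ℝ) 1, D x = 0 := by
  have hleft : ∀ y ∈ Ioc (0 : ℝ) (1 / 2), D (lsvLeft (α j) y) = 0 → D y = 0 := by
    intro y hy h0
    have e := lsvSystem_map_of_le (p := p) (α := α) (K := K) (SR := SR) j hy.2
    have h2 := lsvLeft_le_two_mul hα hy
    refine hS.eq_zero_of_map_eq_zero hD hfix j ⟨hy.1, hy.2.trans (by norm_num)⟩ ?_ (by rw [e, h0])
    rw [e]
    exact ⟨hy.1.trans_le (le_lsvLeft hy.1), by linarith [hy.2]⟩
  have hright : ∀ y ∈ Ioo (1 / 2 : ℝ) 1, D (2 * y - 1) = 0 → D y = 0 := by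
    intro y hy h0
    have e := lsvSystem_map_of_lt (p := p) (α := α) (K := K) hj hy.1
    refine hS.eq_zero_of_map_eq_zero hD hfix j ⟨lt_trans (by norm_num) hy.1, hy.2.le⟩ ?_
      (by rw [e, h0])
    rw [e]
    exact ⟨by linarith [hy.1], by linarith [hy.2]⟩
  have hhalf : D (1 / 2) = 0 := hleft _ ⟨by norm_num, le_rfl⟩ (by rw [lsvLeft_half, h1])
  have hno := @not_isPosInterval D (α j) hα hhalf hleft hright
  intro x hx
  by_contra h0
  rcases mem_halves hx with hx | hx
  · rcases hx.2.eq_or_lt with rfl | hlt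
    · exact h0 hhalf
    · obtain ⟨c, d, hcd⟩ := exists_isPosInterval le_rfl (by norm_num) hl ⟨hx.1, hlt⟩ h0
      exact hno hcd
  · rcases hx.2.eq_or_lt with rfl | hlt
    · exact h0 h1
    · obtain ⟨c, d, hcd⟩ := exists_isPosInterval (by norm_num) le_rfl hr ⟨hx.1, hlt⟩ h0
      exact hno hcd

/-- Fixed densities in the cone are determined by their mass. -/
theorem fixed_unique (hS : (lsvSystem p α K SR).Regular q) {j : ι} (hj : j ∉ SR)
    (hα : 0 < α j) (h₁c : InCone q h₁) (h₂c : InCone q h₂)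
    (h₁f : ∀ x ∈ Ioc (0 : ℝ) 1, (lsvSystem p α K SR).op h₁ x = h₁ x)
    (h₂f : ∀ x ∈ Ioc (0 : ℝ) 1, (lsvSystem p α K SR).op h₂ x = h₂ x)
    (hfin : dens h₁ univ ≠ ⊤) (hmass : dens h₁ univ = dens h₂ univ) :
    ∀ x ∈ Ioc (0 : ℝ) 1, h₁ x = h₂ x := by
  wlog hle : h₂ 1 ≤ h₁ 1 generalizing h₁ h₂
  · exact fun x hx => (this h₂c h₁c h₂f h₁f (hmass ▸ hfin) hmass.symm (le_of_not_ge hle) x hx).symm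
  set S := lsvSystem p α K SR
  set H : ℝ → ℝ := fun x => max (h₁ x) (h₂ x) with hH
  have hHc : InCone q H := h₁c.max h₂c
  have hHle : ∀ x ∈ Ioc (0 : ℝ) 1, H x ≤ S.op H x := fun x hx => max_le
    (by rw [← h₁f x hx]; exact hS.op_mono (fun y _ => le_max_left _ _) x)
    (by rw [← h₂f x hx]; exact hS.op_mono (fun y _ => le_max_right _ _) x)
  have hHf : ∀ x ∈ Ioc (0 : ℝ) 1, H x = S.op H x := hHc.eq_of_le_of_dens_le (hS.inCone_op hHc)
    hHle (dens_univ_max_ne_top h₁c h₂c hfin (hmass ▸ hfin)) (hS.dens_op_univ hHc).le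
  have hD := eq_zero_of_fixed (D := fun x => H x - h₁ x) hS hj hα
    (fun x _ => sub_nonneg.2 (le_max_left _ _))
    (hHc.left.continuousOn.sub h₁c.left.continuousOn)
    (hHc.right.continuousOn.sub h₁c.right.continuousOn)
    (fun x hx => by rw [System.Regular.op_sub, ← hHf x hx, h₁f x hx])
    (by simp only [hH, max_eq_left hle, sub_self])
  have hle' : ∀ x ∈ Ioc (0 : ℝ) 1, h₂ x ≤ h₁ x := fun x hx =>
    (le_max_right _ _).trans_eq (sub_eq_zero.1 (hD x hx))
  exact fun x hx => (h₂c.eq_of_le_of_dens_le h₁c hle' (hmass ▸ hfin) hmass.le x hx).symm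

theorem fixed_pos (hS : (lsvSystem p α K SR).Regular q) {j : ι} (hj : j ∉ SR)
    (hα : 0 < α j) (hc : InCone q h)
    (hf : ∀ x ∈ Ioc (0 : ℝ) 1, (lsvSystem p α K SR).op h x = h x) (hmass : dens h univ ≠ 0) :
    ∃ c > 0, ∀ x ∈ Ioc (0 : ℝ) 1, c ≤ h x := by
  have h1 : h 1 ≠ 0 := by
    intro h0
    refine hmass ?_
    have := eq_zero_of_fixed hS hj hα (fun x hx => hc.nonneg hx) hc.left.continuousOn
      hc.right.continuousOn hf h0
    rw [dens_congr this]
    simp [dens]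
  have h34 : h 1 ≤ h (3 / 4) := hc.right.anti (by norm_num) (by norm_num) (by norm_num)
  have h1' : 0 ≤ h 1 := hc.nonneg (by norm_num)
  have h2 : h (1 / 2) ≠ 0 := by
    intro h0
    have e := lsvSystem_map_of_lt (p := p) (α := α) (K := K) hj (y := 3 / 4) (by norm_num)
    norm_num at e
    have := hS.eq_zero_of_map_eq_zero (fun x hx => hc.nonneg hx) hf j (y := 3 / 4) (by norm_num)
      (by rw [e]; norm_num) (by rw [e, h0])
    exact h1 (by linarith)
  have h2' : 0 ≤ h (1 / 2) := hc.nonneg (by norm_num)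
  refine ⟨min (h (1 / 2)) (h 1), lt_min (h2'.lt_of_ne' h2) (h1'.lt_of_ne' h1), fun x hx => ?_⟩
  rcases mem_halves hx with hx | hx
  · exact (min_le_left _ _).trans (hc.left.anti hx (by norm_num) hx.2)
  · exact (min_le_right _ _).trans (hc.right.anti hx (by norm_num) hx.2)

end

/-- Adding a large multiple of `2 - x` to a Lipschitz function gives a cone function. -/
theorem InCone.of_lipschitz {q : ℕ} (hq : 2 ≤ q) {f : ℝ → ℝ} {C L M : ℝ}
    (hC : ∀ x, |f x| ≤ C) (hL : ∀ x y, |f x - f y| ≤ L * |x - y|) (hL0 : 0 ≤ L)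
    (hM : L + 2 * C ≤ M) : InCone q fun x => f x + M * (2 - x) := by
  have hC0 : 0 ≤ C := (abs_nonneg _).trans (hC 0)
  have hlow : ∀ x ∈ Ioc (0 : ℝ) 1, M - C ≤ f x + M * (2 - x) := by
    intro x hx
    have h1 := (abs_le.1 (hC x)).1
    have h2 : 0 ≤ M * (1 - x) := mul_nonneg (by linarith) (by linarith [hx.2])
    linarith
  refine InCone.of_pieceCone ⟨fun x hx => ?_, fun x hx y hy hxy => ?_, fun x hx y hy hxy => ?_⟩
  · linarith [hlow x hx]
  · have h1 := (abs_le.1 (hL y x)).2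
    rw [abs_of_nonneg (sub_nonneg.2 hxy)] at h1
    have : L * (y - x) ≤ M * (y - x) := mul_le_mul_of_nonneg_right (by linarith)
      (sub_nonneg.2 hxy)
    linarith
  · simp only [sub_zero]
    have h1 := (abs_le.1 (hL y x)).1
    rw [abs_of_nonneg (sub_nonneg.2 hxy)] at h1
    have h2 := hlow y hy
    set Fy := f y + M * (2 - y) with hFy
    have hyx := sub_nonneg.2 hxy
    have h3 : f x + M * (2 - x) ≤ Fy * (1 + 2 * (y - x)) := by
      have : (L + M) * (y - x) ≤ 2 * Fy * (y - x) :=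
        mul_le_mul_of_nonneg_right (by linarith) hyx
      rw [hFy] at this ⊢
      linarith
    have h4 : x ^ q * (1 + 2 * (y - x)) ≤ y ^ q := by
      obtain ⟨k, rfl⟩ := Nat.exists_eq_add_of_le' hq
      have hx0 := hx.1.le
      have h5 : x ^ 2 * (1 + 2 * (y - x)) ≤ y ^ 2 := by
        have : x * x * (y - x) ≤ x * 1 * (y - x) := by gcongr; exact hx.2
        nlinarith
      rw [pow_add, pow_add, mul_assoc]
      have h6 : 0 ≤ x ^ 2 * (1 + 2 * (y - x)) := by positivity
      exact mul_le_mul (pow_le_pow_left₀ hx0 hxy k) h5 h6 (pow_nonneg hy.1.le k)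
    have hFy0 : 0 ≤ Fy := by linarith
    calc x ^ q * (f x + M * (2 - x)) ≤ x ^ q * (Fy * (1 + 2 * (y - x))) := by
          have := hx.1.le
          gcongr
      _ = x ^ q * (1 + 2 * (y - x)) * Fy := by ring
      _ ≤ y ^ q * Fy := by gcongr

theorem exists_lipschitz_approx {g : ℝ → ℝ} (hg : IntegrableOn g (Ioc 0 1)) {ε : ℝ}
    (hε : 0 < ε) : ∃ (f : ℝ → ℝ) (C L : ℝ), 0 ≤ L ∧ (∀ x, |f x| ≤ C) ∧
      (∀ x y, |f x - f y| ≤ L * |x - y|) ∧ dens (fun x => |g x - f x|) univ ≤ ENNReal.ofReal ε := by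
  obtain ⟨f, hc, hs, hf⟩ := MemLp.exist_eLpNorm_sub_le ENNReal.one_ne_top le_rfl
    (memLp_one_iff_integrable.2 hg) hε
  obtain ⟨C, hC⟩ := hc.exists_bound_of_continuous hs.continuous
  obtain ⟨L, hL⟩ := hs.lipschitzWith_of_hasCompactSupport hc (by simp)
  refine ⟨f, C, L, L.2, hC, fun x y => ?_, ?_⟩
  · simpa [Real.dist_eq] using hL.dist_le_mul x y
  · rw [eLpNorm_one_eq_lintegral_enorm] at hf
    rw [dens_apply _ MeasurableSet.univ, univ_inter]
    refine le_trans (le_of_eq ?_) hf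
    refine lintegral_congr fun x => ?_
    rw [Pi.sub_apply, ← ofReal_norm, Real.norm_eq_abs]

theorem dens_add_dens_le {q : ℕ} {g f₁ f₂ e : ℝ → ℝ} (hf₁ : InCone q f₁) (hf₂ : InCone q f₂)
    (h : ∀ x ∈ Ioc (0 : ℝ) 1, ENNReal.ofReal (g x) + ENNReal.ofReal (f₂ x) ≤
      ENNReal.ofReal (f₁ x) + ENNReal.ofReal (e x)) :
    dens g + dens f₂ ≤ dens f₁ + dens e := by
  refine Measure.le_iff.2 fun E hE => ?_
  have hm : ∀ {f}, InCone q f →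
      AEMeasurable (fun x => ENNReal.ofReal (f x)) (volume.restrict (E ∩ Ioc 0 1)) :=
    fun hf => (hf.aemeasurable.mono_measure
      (Measure.restrict_mono inter_subset_right le_rfl)).ennreal_ofReal
  simp only [Measure.add_apply, dens_apply _ hE]
  rw [← lintegral_add_right' _ (hm hf₂), ← lintegral_add_left' (hm hf₁)]
  exact setLIntegral_mono' (hE.inter measurableSet_Ioc) fun x hx => h x hx.2

theorem dens_univ_le_add {q : ℕ} {g f₁ f₂ e : ℝ → ℝ} (hf₂ : InCone q f₂)
    (hg : IntegrableOn g (Ioc 0 1))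
    (h : ∀ x ∈ Ioc (0 : ℝ) 1, ENNReal.ofReal (f₁ x) ≤
      ENNReal.ofReal (g x) + ENNReal.ofReal (e x) + ENNReal.ofReal (f₂ x)) :
    dens f₁ univ ≤ dens g univ + dens e univ + dens f₂ univ := by
  simp only [dens_apply _ MeasurableSet.univ, univ_inter]
  rw [← lintegral_add_left' hg.aestronglyMeasurable.aemeasurable.ennreal_ofReal,
    ← lintegral_add_right' _ hf₂.aemeasurable.ennreal_ofReal]
  exact setLIntegral_mono' measurableSet_Ioc h

theorem dens_univ_lt_top {f : ℝ → ℝ} {C : ℝ} (hf : ∀ x ∈ Ioc (0 : ℝ) 1, f x ≤ C) :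
    dens f univ < ⊤ := by
  rw [dens_apply _ MeasurableSet.univ, univ_inter]
  refine (setLIntegral_mono' measurableSet_Ioc fun x hx =>
    ENNReal.ofReal_le_ofReal (hf x hx)).trans_lt ?_
  simp

theorem inv_mul_sum_const (n : ℕ) (c : ENNReal) :
    ENNReal.ofReal ((n : ℝ) + 1)⁻¹ * ∑ _k ∈ Finset.range (n + 1), c = c := by
  have hn : ENNReal.ofReal ((n : ℝ) + 1)⁻¹ * ((n : ENNReal) + 1) = 1 := by
    have : ((n : ENNReal) + 1) = ENNReal.ofReal ((n : ℝ) + 1) := by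
      rw [ENNReal.ofReal_add (by positivity) zero_le_one]; simp
    rw [this, ← ENNReal.ofReal_mul (by positivity), inv_mul_cancel₀ (by positivity)]
    simp
  rw [Finset.sum_const, Finset.card_range, nsmul_eq_mul, ← mul_assoc]
  push_cast
  rw [hn, one_mul]

namespace System.Regular

variable {ι : Type*} [Fintype ι] {S : System ι} {q : ℕ}

theorem dens_iterate_univ (hS : S.Regular q) {f : ℝ → ℝ} (hf : InCone q f) (k : ℕ) :
    dens (S.op^[k] f) univ = dens f univ := by
  induction k with
  | zero => rfl
  | succ k ih => rw [Function.iterate_succ_apply', hS.dens_op_univ (hS.inCone_iterate hf k), ih]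

theorem dens_average_univ (hS : S.Regular q) {f : ℝ → ℝ} (hf : InCone q f) (n : ℕ) :
    dens (average (fun k => S.op^[k] f) n) univ = dens f univ := by
  rw [dens_average (fun k => hS.inCone_iterate hf k) n MeasurableSet.univ]
  simp only [hS.dens_iterate_univ hf, inv_mul_sum_const]

theorem add_average_le (hS : S.Regular q) {μ ε : Measure ℝ} {f₁ f₂ : ℝ → ℝ}
    (hf₁ : InCone q f₁) (hf₂ : InCone q f₂) (hμ : S.push μ = μ)
    (h : μ + dens f₂ ≤ dens f₁ + ε) (n : ℕ) {E : Set ℝ} (hE : MeasurableSet E) :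
    μ E + dens (average (fun k => S.op^[k] f₂) n) E ≤
      dens (average (fun k => S.op^[k] f₁) n) E + ε univ := by
  have hpush : ∀ k, μ + dens (S.op^[k] f₂) ≤ dens (S.op^[k] f₁) + S.push^[k] ε ∧
      (S.push^[k] ε) univ = ε univ := by
    intro k
    induction k with
    | zero => exact ⟨h, rfl⟩
    | succ k ih =>
      simp only [Function.iterate_succ_apply']
      refine ⟨?_, by rw [hS.push_univ, ih.2]⟩
      have := hS.push_mono ih.1
      rwa [hS.push_add, hS.push_add, hμ, hS.push_dens (hS.inCone_iterate hf₁ k),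
        hS.push_dens (hS.inCone_iterate hf₂ k)] at this
  have hk : ∀ k, μ E + dens (S.op^[k] f₂) E ≤ dens (S.op^[k] f₁) E + ε univ := by
    intro k
    have h1 := Measure.le_iff.1 (hpush k).1 E hE
    rw [Measure.add_apply, Measure.add_apply] at h1
    refine h1.trans (add_le_add_right ?_ _)
    rw [← (hpush k).2]
    exact measure_mono (subset_univ _)
  rw [dens_average (fun k => hS.inCone_iterate hf₁ k) n hE,
    dens_average (fun k => hS.inCone_iterate hf₂ k) n hE, ← inv_mul_sum_const n (μ E), ← inv_mul_sum_const n (ε univ), ← mul_add,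
    ← mul_add, ← Finset.sum_add_distrib, ← Finset.sum_add_distrib]
  exact mul_le_mul_right (Finset.sum_le_sum fun k _ => hk k) _

end System.Regular

theorem measure_le_of_average_tendsto {ι : Type*} [Fintype ι] {S : System ι} {q : ℕ}
    (hS : S.Regular q) (hq : 2 ≤ q) {g h : ℝ → ℝ} (hg : IntegrableOn g (Ioc 0 1))
    (hg0 : ∀ x, 0 ≤ g x) (hμ : S.push (dens g) = dens g) (hg1 : dens g univ = 1)
    (hh : dens h univ = 1)
    (hlim : ∀ f, InCone q f → (∃ C, ∀ x ∈ Ioc (0 : ℝ) 1, f x ≤ C) → ∀ ψ : ℕ → ℕ, StrictMono ψ →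
      ∃ φ : ℕ → ℕ, StrictMono φ ∧ ∀ E, MeasurableSet E →
        Tendsto (fun n => dens (average (fun k => S.op^[k] f) (ψ (φ n))) E) atTop
          (𝓝 (dens f univ * dens h E))) :
    dens g ≤ dens h := by
  refine Measure.le_iff.2 fun E hE => ?_
  have hhE : dens h E ≤ 1 := hh ▸ measure_mono (subset_univ _)
  have key : ∀ ε : ℝ, 0 < ε →
      dens g E ≤ dens h E + (ENNReal.ofReal ε + ENNReal.ofReal ε) := by
    intro ε hε
    obtain ⟨f, C, L, hL0, hC, hL, hgf⟩ := exists_lipschitz_approx hg hε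
    have hC0 : 0 ≤ C := (abs_nonneg _).trans (hC 0)
    set M := L + 2 * C with hM
    have hM0 : 0 ≤ M := by positivity
    set f₁ : ℝ → ℝ := fun x => f x + M * (2 - x) with hf₁
    set f₂ : ℝ → ℝ := fun x => 0 + M * (2 - x) with hf₂
    have hf₁c : InCone q f₁ := InCone.of_lipschitz hq hC hL hL0 le_rfl
    have hf₂c : InCone q f₂ := InCone.of_lipschitz (C := 0) (L := 0) hq (by simp) (by simp) le_rfl
      (by simpa using hM0)
    have hle : ∀ x ∈ Ioc (0 : ℝ) 1, M * (2 - x) ≤ M * 2 := fun x hx =>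
      mul_le_mul_of_nonneg_left (by linarith [hx.1]) hM0
    have hb₁ : ∀ x ∈ Ioc (0 : ℝ) 1, f₁ x ≤ C + M * 2 := fun x hx =>
      add_le_add ((le_abs_self _).trans (hC x)) (hle x hx)
    have hb₂ : ∀ x ∈ Ioc (0 : ℝ) 1, f₂ x ≤ 0 + M * 2 := fun x hx =>
      add_le_add le_rfl (hle x hx)
    have hup : dens g + dens f₂ ≤ dens f₁ + dens fun x => |g x - f x| := by
      refine dens_add_dens_le hf₁c hf₂c fun x hx => ?_
      rw [← ENNReal.ofReal_add (hg0 x) (hf₂c.nonneg hx),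
        ← ENNReal.ofReal_add (hf₁c.nonneg hx) (abs_nonneg _)]
      refine ENNReal.ofReal_le_ofReal ?_
      have := le_abs_self (g x - f x)
      simp only [hf₁, hf₂]
      linarith
    have hmass : dens f₁ univ ≤ dens g univ + dens (fun x => |g x - f x|) univ + dens f₂ univ := by
      refine dens_univ_le_add hf₂c hg fun x hx => ?_
      rw [← ENNReal.ofReal_add (hg0 x) (abs_nonneg _),
        ← ENNReal.ofReal_add (add_nonneg (hg0 x) (abs_nonneg _)) (hf₂c.nonneg hx)]
      refine ENNReal.ofReal_le_ofReal ?_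
      have := neg_abs_le (g x - f x)
      simp only [hf₁, hf₂]
      linarith
    obtain ⟨φ₁, hφ₁, hl₁⟩ := hlim f₁ hf₁c ⟨_, hb₁⟩ id strictMono_id
    obtain ⟨φ₂, hφ₂, hl₂⟩ := hlim f₂ hf₂c ⟨_, hb₂⟩ φ₁ hφ₁
    have hl₁' := (hl₁ E hE).comp hφ₂.tendsto_atTop
    have hlimit : dens g E + dens f₂ univ * dens h E ≤
        dens f₁ univ * dens h E + dens (fun x => |g x - f x|) univ :=
      le_of_tendsto_of_tendsto' ((hl₂ E hE).const_add _) (hl₁'.add_const _) fun n =>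
        hS.add_average_le hf₁c hf₂c hμ hup _ hE
    have hm₂ : dens f₂ univ * dens h E ≠ ⊤ := ENNReal.mul_ne_top (dens_univ_lt_top hb₂).ne
      (ne_top_of_le_ne_top ENNReal.one_ne_top hhE)
    refine (ENNReal.add_le_add_iff_right hm₂).1 (hlimit.trans ?_)
    calc dens f₁ univ * dens h E + dens (fun x => |g x - f x|) univ
        ≤ (1 + ENNReal.ofReal ε + dens f₂ univ) * dens h E + ENNReal.ofReal ε := by
          rw [hg1] at hmass
          gcongr
          exact hmass.trans (by gcongr)
      _ = dens h E + (ENNReal.ofReal ε * dens h E + ENNReal.ofReal ε) +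
          dens f₂ univ * dens h E := by ring
      _ ≤ dens h E + (ENNReal.ofReal ε * 1 + ENNReal.ofReal ε) +
          dens f₂ univ * dens h E := by gcongr
      _ = _ := by rw [mul_one]
  refine ENNReal.le_of_forall_pos_le_add fun ε hε _ => ?_
  have h1 := key (ε / 2) (by positivity)
  rwa [← ENNReal.ofReal_add (by positivity) (by positivity), add_halves,
    ENNReal.ofReal_coe_nnreal] at h1

theorem rpow_sum_tendsto {ι : Type*} {p K : ι → ℝ} {SR : Finset ι}
    (hK : ∀ r ∈ SR, K r ∈ Ioo (0 : ℝ) 1) (a : ℝ) :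
    Tendsto (fun δ => ∑ r ∈ SR, p r * K r ^ (-δ)) (𝓝 a) (𝓝 (∑ r ∈ SR, p r * K r ^ (-a))) := by
  refine tendsto_finsetSum _ fun r hr => Tendsto.const_mul _ ?_
  exact (Real.continuousAt_const_rpow (hK r hr).1.ne').tendsto.comp (continuous_neg.tendsto a)

theorem rpow_sum_mono {ι : Type*} {p K : ι → ℝ} {SR : Finset ι} (hp : ∀ j, 0 < p j)
    (hK : ∀ r ∈ SR, K r ∈ Ioo (0 : ℝ) 1) {a b : ℝ} (hab : a ≤ b) :
    ∑ r ∈ SR, p r * K r ^ (-a) ≤ ∑ r ∈ SR, p r * K r ^ (-b) :=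
  Finset.sum_le_sum fun r hr => mul_le_mul_of_nonneg_left
    (Real.rpow_le_rpow_of_exponent_ge (hK r hr).1 (hK r hr).2.le (neg_le_neg hab)) (hp r).le

section

variable {ι : Type*} [DecidableEq ι] [Fintype ι] {p α K : ι → ℝ} {SR : Finset ι} {q : ℕ}
  {αmin β : ℝ} {f h : ℝ → ℝ}

/-- The orbit of a bounded cone function satisfies a uniform power bound. -/
theorem exists_powerBound_iterate (hα : ∀ j, 0 < α j)
    (hK : ∀ r ∈ SR, K r ∈ Ioo (0 : ℝ) 1) (hp : ∀ j, 0 < p j) (hp1 : ∑ j, p j = 1)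
    (hq2 : 2 ≤ q) (hq : ∀ j, 1 + α j ≤ q) {j₀ : ι} (hj₀ : α j₀ = αmin) (hα1 : αmin < 1)
    (hβ : αmin < β) (hβ1 : β ≤ 1) (hη : ∑ r ∈ SR, p r * K r ^ (-β) < 1) (hf : InCone q f)
    {C : ℝ} (hC : ∀ x ∈ Ioc (0 : ℝ) 1, f x ≤ C) :
    ∃ A > 0, ∃ B > 0, ∀ k, PowerBound αmin β A B ((lsvSystem p α K SR).op^[k] f) := by
  have hS := lsvSystem_regular hα hK hp hp1 hq2 hq
  have hα0 : 0 < αmin := hj₀ ▸ hα j₀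
  have hβ0 : 0 < β := hα0.trans hβ
  have hC0 : 0 ≤ C := (hf.nonneg (x := 1) (by norm_num)).trans (hC 1 (by norm_num))
  have hη' := sub_pos.2 hη
  set m := (dens f univ).toReal with hm
  have hm0 : 0 ≤ m := ENNReal.toReal_nonneg
  set B := max (C + 1) (8 * m / (1 - ∑ r ∈ SR, p r * K r ^ (-β))) with hB
  have hCB : C + 1 ≤ B := le_max_left _ _
  have hmB : 8 * m ≤ (1 - ∑ r ∈ SR, p r * K r ^ (-β)) * B := by
    have : 8 * m / (1 - ∑ r ∈ SR, p r * K r ^ (-β)) ≤ B := le_max_right _ _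
    rwa [div_le_iff₀' hη'] at this
  have hpβ : 0 < p j₀ * β := mul_pos (hp j₀) hβ0
  set A := max (C + 1) (3 * B / (p j₀ * β)) with hA
  have hCA : C + 1 ≤ A := le_max_left _ _
  have hBA : 3 * B ≤ p j₀ * β * A := by
    have : 3 * B / (p j₀ * β) ≤ A := le_max_right _ _
    rwa [div_le_iff₀' hpβ] at this
  refine ⟨A, by linarith, B, by linarith, fun k => ?_⟩
  induction k with
  | zero => exact PowerBound.of_le_const hα0 hβ1 hC0 (by linarith) (by linarith) hC
  | succ k ih =>
    rw [Function.iterate_succ_apply']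
    refine powerBound_op hα hK hp hp1 hq hj₀ hα1 hβ hβ1 (hS.inCone_iterate hf k) hm0 ?_
      (by linarith) (by linarith) hmB hBA ih
    rw [hS.dens_iterate_univ hf, hm, ENNReal.ofReal_toReal (dens_univ_lt_top hC).ne]

theorem InCone.one (q : ℕ) : InCone q fun _ => 1 := by
  refine InCone.of_pieceCone ⟨fun _ _ => zero_le_one, fun _ _ _ _ _ => le_rfl,
    fun x hx y hy hxy => ?_⟩
  simp only [sub_zero, mul_one]
  exact pow_le_pow_left₀ hx.1.le hxy q

theorem dens_one_univ : dens (fun _ => 1) univ = 1 := by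
  rw [dens_apply _ MeasurableSet.univ, univ_inter]; simp

/-- A fixed probability density satisfying the power bound with exponent `β`. -/
theorem exists_fixed_density (hα : ∀ j, 0 < α j)
    (hK : ∀ r ∈ SR, K r ∈ Ioo (0 : ℝ) 1) (hp : ∀ j, 0 < p j) (hp1 : ∑ j, p j = 1)
    (hq2 : 2 ≤ q) (hq : ∀ j, 1 + α j ≤ q) {j₀ : ι} (hj₀ : α j₀ = αmin) (hα1 : αmin < 1)
    (hβ : αmin < β) (hβ1 : β ≤ 1) (hη : ∑ r ∈ SR, p r * K r ^ (-β) < 1) :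
    ∃ A > 0, ∃ B > 0, ∃ h, InCone q h ∧ PowerBound αmin β A B h ∧
      (∀ x ∈ Ioc (0 : ℝ) 1, (lsvSystem p α K SR).op h x = h x) ∧ dens h univ = 1 := by
  have hS := lsvSystem_regular hα hK hp hp1 hq2 hq
  have hα0 : 0 < αmin := hj₀ ▸ hα j₀
  obtain ⟨A, hA, B, hB, hb⟩ := exists_powerBound_iterate hα hK hp hp1 hq2 hq hj₀ hα1 hβ hβ1 hη
    (InCone.one q) fun _ _ => le_rfl
  obtain ⟨φ, -, h, hc, hpb, hfix, hlim⟩ := hS.exists_fixed_limit hα0 hβ (InCone.one q) hb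
    strictMono_id
  refine ⟨A, hA, B, hB, h, hc, hpb, hfix, ?_⟩
  refine tendsto_nhds_unique (hlim univ MeasurableSet.univ) ?_
  simp only [hS.dens_average_univ (InCone.one q), dens_one_univ]
  exact tendsto_const_nhds

/-- Averages of bounded cone functions subconverge to multiples of the fixed density. -/
theorem exists_average_tendsto (hα : ∀ j, 0 < α j)
    (hK : ∀ r ∈ SR, K r ∈ Ioo (0 : ℝ) 1) (hp : ∀ j, 0 < p j) (hp1 : ∑ j, p j = 1)
    (hq2 : 2 ≤ q) (hq : ∀ j, 1 + α j ≤ q) {j₀ : ι} (hj₀ : α j₀ = αmin) (hα1 : αmin < 1)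
    (hβ : αmin < β) (hβ1 : β ≤ 1) (hη : ∑ r ∈ SR, p r * K r ^ (-β) < 1) {j : ι} (hj : j ∉ SR)
    (hh : InCone q h) (hfix : ∀ x ∈ Ioc (0 : ℝ) 1, (lsvSystem p α K SR).op h x = h x)
    (hh1 : dens h univ = 1) (hf : InCone q f) {C : ℝ} (hC : ∀ x ∈ Ioc (0 : ℝ) 1, f x ≤ C)
    {ψ : ℕ → ℕ} (hψ : StrictMono ψ) :
    ∃ φ : ℕ → ℕ, StrictMono φ ∧ ∀ E, MeasurableSet E → Tendsto
      (fun n => dens (average (fun k => (lsvSystem p α K SR).op^[k] f) (ψ (φ n))) E) atTop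
      (𝓝 (dens f univ * dens h E)) := by
  have hS := lsvSystem_regular hα hK hp hp1 hq2 hq
  have hα0 : 0 < αmin := hj₀ ▸ hα j₀
  obtain ⟨A, hA, B, hB, hb⟩ := exists_powerBound_iterate hα hK hp hp1 hq2 hq hj₀ hα1 hβ hβ1 hη
    hf hC
  obtain ⟨φ, hφ, h', hc, -, hfix', hlim⟩ := hS.exists_fixed_limit hα0 hβ hf hb hψ
  refine ⟨φ, hφ, fun E hE => ?_⟩
  have hfin := (dens_univ_lt_top hC).ne
  have hmass : dens h' univ = dens f univ := by
    refine tendsto_nhds_unique (hlim univ MeasurableSet.univ) ?_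
    simp only [hS.dens_average_univ hf]
    exact tendsto_const_nhds
  have hc0 : 0 ≤ (dens f univ).toReal := ENNReal.toReal_nonneg
  have hE' : ∀ E, MeasurableSet E →
      dens (fun x => (dens f univ).toReal * h x) E = dens f univ * dens h E := fun E hE => by
    rw [dens_const_mul hc0 E hE, ENNReal.ofReal_toReal hfin]
  have heq := fixed_unique hS hj (hα j) hc (hh.const_mul hc0) hfix'
    (fun x hx => by rw [System.Regular.op_const_mul, hfix x hx]) (hmass ▸ hfin)
    (by rw [hE' _ MeasurableSet.univ, hh1, mul_one, hmass])
  rw [← hE' E hE, ← dens_congr heq]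
  exact hlim E hE

end

end LSV

open LSV

/-- Theorem 1.2(2): properties of the density of the unique acs probability measure
when `η < 1`. -/
theorem density_properties_of_acs
    (N : ℕ) (hN : 0 < N)
    (α K : Fin N → ℝ) (SR : Finset (Fin N))
    (hSR : SR.Nonempty) (hSS : SRᶜ.Nonempty)
    (hα : ∀ j, 0 < α j)
    (hK : ∀ r ∈ SR, K r ∈ Set.Ioo (0 : ℝ) 1)
    (T : Fin N → ℝ → ℝ)
    (hT : ∀ j, T j = if j ∈ SR then rMap (α j) (K j) else lsvMap (α j))
    (αmin : ℝ) (hαmin : IsLeast (Set.range α) αmin) (hαmin1 : αmin < 1)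
    (p : Fin N → ℝ) (hp : ∀ j, 0 < p j) (hp1 : ∑ j, p j = 1)
    (hη : ∑ r ∈ SR, p r * K r ^ (-αmin) < 1)
    (γ : ℝ) (hγ : γ = sSup {δ : ℝ | 0 ≤ δ ∧ ∑ r ∈ SR, p r * K r ^ (-δ) < 1})
    (μ : Measure ℝ) (hμprob : IsProbabilityMeasure μ)
    (hμac : μ ≪ volume.restrict (Set.Icc (0 : ℝ) 1))
    (hμstat : ∀ A : Set ℝ, MeasurableSet A → A ⊆ Set.Icc (0 : ℝ) 1 →
      ∑ j, ENNReal.ofReal (p j) * μ (T j ⁻¹' A) = μ A) :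
    ∃ g : ℝ → ℝ,
      μ = (volume.restrict (Set.Icc (0 : ℝ) 1)).withDensity
            (fun x => ENNReal.ofReal (g x)) ∧
      (∃ c > 0, ∀ x ∈ Set.Ioc (0 : ℝ) 1, c ≤ g x) ∧
      AntitoneOn g (Set.Ioc (0 : ℝ) (1 / 2)) ∧
      AntitoneOn g (Set.Ioc (1 / 2 : ℝ) 1) ∧
      LocallyLipschitzOn (Set.Ioc (0 : ℝ) (1 / 2)) g ∧
      LocallyLipschitzOn (Set.Ioc (1 / 2 : ℝ) 1) g ∧
      ∀ β : ℝ, αmin < β → β < γ → 0 < β → β ≤ 1 →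
        ∃ a₁ > (0 : ℝ), ∃ a₂ > (0 : ℝ),
          (∀ x ∈ Set.Ioc (0 : ℝ) (1 / 2), g x ≤ a₁ * x ^ (-αmin - 1 + β)) ∧
          (∀ x ∈ Set.Ioc (1 / 2 : ℝ) 1, g x ≤ a₂ * (x - 1 / 2) ^ (-1 + β)) := by
  obtain ⟨j₀, hj₀⟩ := hαmin.1
  obtain ⟨j₁, hj₁⟩ := hSS
  rw [Finset.mem_compl] at hj₁
  have hα0 : 0 < αmin := hj₀ ▸ hα j₀
  obtain ⟨q, hq2, hq⟩ : ∃ q : ℕ, 2 ≤ q ∧ ∀ j, 1 + α j ≤ q := by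
    obtain ⟨n, hn⟩ := exists_nat_ge (∑ j, (1 + α j))
    refine ⟨max 2 n, le_max_left _ _, fun j => ?_⟩
    have h1 := Finset.single_le_sum (f := fun j => 1 + α j)
      (fun j _ => (add_pos one_pos (hα j)).le) (Finset.mem_univ j)
    have h2 : (n : ℝ) ≤ (max 2 n : ℕ) := Nat.cast_le.2 (le_max_right _ _)
    linarith
  have hS := lsvSystem_regular hα hK hp hp1 hq2 hq
  set S := lsvSystem p α K SR with hSdef
  have hmap : ∀ j, T j = S.map j := by
    intro j
    ext y
    rw [hT]
    by_cases hj : j ∈ SR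
    · simp only [if_pos hj, rMap, System.map, S, lsvSystem, leftBranch, quadraticBranch]
    · simp only [if_neg hj, lsvMap, System.map, S, lsvSystem, leftBranch, linearBranch]
  obtain ⟨β₀, ⟨hβ₀η, hβ₀1⟩, hβ₀⟩ : ∃ β₀, (∑ r ∈ SR, p r * K r ^ (-β₀) < 1 ∧ β₀ < 1) ∧
      αmin < β₀ :=
    (((((rpow_sum_tendsto hK αmin).eventually (gt_mem_nhds hη)).and
      (gt_mem_nhds hαmin1)).filter_mono nhdsWithin_le_nhds).and
      (self_mem_nhdsWithin (s := Ioi αmin))).exists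
  obtain ⟨-, -, -, -, h, hc, -, hfix, hmass⟩ := exists_fixed_density hα hK hp hp1 hq2 hq hj₀
    hαmin1 hβ₀ hβ₀1.le hβ₀η
  have hprob : IsProbabilityMeasure (dens h) := ⟨hmass⟩
  set g : ℝ → ℝ := fun x => (μ.rnDeriv (volume.restrict (Icc 0 1)) x).toReal with hg
  have hgμ : dens g = μ := by
    rw [dens, restrict_Ioc_eq_restrict_Icc]
    conv_rhs => rw [← Measure.withDensity_rnDeriv_eq μ _ hμac]
    refine withDensity_congr_ae ?_
    filter_upwards [Measure.rnDeriv_lt_top μ (volume.restrict (Icc (0 : ℝ) 1))] with x hx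
    exact ENNReal.ofReal_toReal hx.ne
  have hpush : S.push μ = μ := by
    have hsub : ∀ A, MeasurableSet A → A ⊆ Icc (0 : ℝ) 1 → S.push μ A = μ A := by
      intro A hA hA1
      rw [hS.push_apply μ hA, ← hμstat A hA hA1]
      simp only [hmap]
      rfl
    have hcompl : μ (Icc (0 : ℝ) 1)ᶜ = 0 := hμac (by
      rw [Measure.restrict_apply measurableSet_Icc.compl, compl_inter_self, measure_empty])
    have hunit : μ (Icc (0 : ℝ) 1) = 1 := (prob_compl_eq_zero_iff measurableSet_Icc).1 hcompl
    have hpuniv : S.push μ univ = 1 := by rw [hS.push_univ, measure_univ]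
    have : IsProbabilityMeasure (S.push μ) := ⟨hpuniv⟩
    have hpcompl : S.push μ (Icc (0 : ℝ) 1)ᶜ = 0 := by
      rw [prob_compl_eq_zero_iff measurableSet_Icc, hsub _ measurableSet_Icc le_rfl, hunit]
    ext A hA
    rw [← measure_inter_conull hcompl, ← measure_inter_conull hpcompl,
      hsub _ (hA.inter measurableSet_Icc) inter_subset_right]
  have hμh : μ = dens h := by
    refine Measure.eq_of_le_of_isProbabilityMeasure ?_
    rw [← hgμ]
    refine measure_le_of_average_tendsto hS hq2 ?_ (fun x => ENNReal.toReal_nonneg)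
      (by rw [hgμ, hpush]) (by rw [hgμ, measure_univ]) hmass fun f hf ⟨C, hC⟩ ψ hψ =>
        exists_average_tendsto hα hK hp hp1 hq2 hq hj₀ hαmin1 hβ₀ hβ₀1.le hβ₀η hj₁ hc hfix hmass
          hf hC hψ
    rw [IntegrableOn, restrict_Ioc_eq_restrict_Icc]
    exact Measure.integrable_toReal_rnDeriv
  refine ⟨h, ?_, fixed_pos hS hj₁ (hα j₁) hc hfix (by rw [hmass]; exact one_ne_zero),
    hc.left.anti, hc.right.anti, hc.left.locallyLipschitzOn, hc.right.locallyLipschitzOn,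
    fun β hβ hβγ _ hβ1 => ?_⟩
  · rw [hμh, dens, restrict_Ioc_eq_restrict_Icc]
  · rw [hγ] at hβγ
    have hne : {δ : ℝ | 0 ≤ δ ∧ ∑ r ∈ SR, p r * K r ^ (-δ) < 1}.Nonempty := ⟨αmin, hα0.le, hη⟩
    obtain ⟨δ, ⟨-, hδ⟩, hβδ⟩ := exists_lt_of_lt_csSup hne hβγ
    obtain ⟨A, hA, B, hB, h', hc', hb', hfix', hmass'⟩ := exists_fixed_density hα hK hp hp1 hq2
      hq hj₀ hαmin1 hβ hβ1 ((rpow_sum_mono hp hK hβδ.le).trans_lt hδ)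
    have heq := fixed_unique hS hj₁ (hα j₁) hc hc' hfix hfix'
      (by rw [hmass]; exact ENNReal.one_ne_top) (hmass.trans hmass'.symm)
    refine ⟨A, hA, B, hB, fun x hx => ?_, fun x hx => ?_⟩
    · rw [heq x ⟨hx.1, hx.2.trans (by norm_num)⟩]
      exact hb'.left x hx
    · rw [heq x ⟨lt_trans (by norm_num) hx.1, hx.2⟩]
      exact hb'.right x hx
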